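/- Let h : K → K be a homeomorphism. Then there exists an integer b such that h(x̄) = σ̂^{−b}(x̄) for every folding point x̄ ∈ F, and such that for every x̄ ∈ K the points h(x̄) and σ̂^{−b}(x̄) lie in the same composant of K (that is, there is a proper subcontinuum of K containing both h(x̄) and σ̂^{−b}(x̄)). -/

import Mathlib

open Set Filter Topology Function

noncomputable section

/-- The tent map with slope `s`. -/
def tent (s : ℝ) (x : ℝ) : ℝ := min (s * x) (s * (1 - x))

/-- The ω-limit set of `c` under iteration of `f`. -/
def omegaSet (f : ℝ → ℝ) (c : ℝ) : Set ℝ :=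
  {y | ∃ φ : ℕ → ℕ, StrictMono φ ∧ Tendsto (fun k => f^[φ k] c) atTop (𝓝 y)}

/-- The inverse limit space `K = lim←([0,1], T)`, as a subset of `ℕ → ℝ`. -/
def invLim (s : ℝ) : Set (ℕ → ℝ) :=
  {x | (∀ n, x n ∈ Icc (0 : ℝ) 1) ∧ ∀ n, x n = tent s (x (n + 1))}

/-- The `n`-th coordinate projection `π_n : K → [0,1]`. -/
def proj (s : ℝ) (n : ℕ) (x : invLim s) : ℝ := (x : ℕ → ℝ) n

/-- The inverse shift homeomorphism `σ̂⁻¹(x₀,x₁,…) = (x₁,x₂,…)` as a map `K → K`. -/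
def shiftInvFun (s : ℝ) (x : invLim s) : invLim s :=
  ⟨fun n => (x : ℕ → ℝ) (n + 1), fun n => x.2.1 (n + 1), fun n => x.2.2 (n + 1)⟩

/-- The shift homeomorphism `σ̂(x₀,x₁,…) = (T x₀, x₀, x₁, …)` as a map `K → K`. -/
def shiftFwdFun (s : ℝ) (hs1 : Real.sqrt 2 < s) (hs2 : s < 2) (x : invLim s) : invLim s := by
  refine ⟨fun n => Nat.casesOn n (tent s ((x : ℕ → ℝ) 0)) (fun k => (x : ℕ → ℝ) k), ?_, ?_⟩
  · intro n
    cases n with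
    | zero =>
      have hx0 := x.2.1 0
      have hs0 : 0 ≤ s := le_of_lt (lt_of_le_of_lt (Real.sqrt_nonneg 2) hs1)
      constructor
      · exact le_min (mul_nonneg hs0 hx0.1) (mul_nonneg hs0 (by linarith [hx0.2]))
      · rcases le_total ((x : ℕ → ℝ) 0) (1 / 2) with hc | hc
        · exact le_trans (min_le_left _ _) (by nlinarith [hx0.1, hx0.2])
        · exact le_trans (min_le_right _ _) (by nlinarith [hx0.1, hx0.2])
    | succ k => exact x.2.1 k
  · intro n
    cases n with
    | zero => rfl
    | succ k => exact x.2.2 k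

/-- The integer power `σ̂^b` of the shift homeomorphism : for `b ≥ 0` it is the `b`-th iterate
of `σ̂`, and for `b < 0` the `|b|`-th iterate of `σ̂⁻¹`. -/
def shiftZ (s : ℝ) (hs1 : Real.sqrt 2 < s) (hs2 : s < 2) (b : ℤ) : invLim s → invLim s :=
  if 0 ≤ b then (shiftFwdFun s hs1 hs2)^[b.toNat] else (shiftInvFun s)^[(-b).toNat]

/-- The set `F` of folding points of `K`. -/
def foldingPts (s : ℝ) : Set (invLim s) :=
  {x | ∀ n, proj s n x ∈ omegaSet (tent s) (1 / 2)}

/-- The set `E_p` of `p`-points of `K`. -/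
def pPoints (s : ℝ) (p : ℕ) : Set (invLim s) :=
  {x | ∃ n, p < n ∧ proj s n x = 1 / 2}

/-- `A` is an arc with endpoints `a` and `b`. -/
def IsArcWith {X : Type*} [TopologicalSpace X] (A : Set X) (a b : X) : Prop :=
  ∃ f : unitInterval → X, Topology.IsEmbedding f ∧ range f = A ∧ f 0 = a ∧ f 1 = b

/-- `A` is an arc (a homeomorphic copy of `[0,1]`). -/
def IsArc {X : Type*} [TopologicalSpace X] (A : Set X) : Prop :=
  ∃ a b, IsArcWith A a b

/-- `A` is an arc with endpoints `a`, `b`, possibly degenerate (a single point when `a = b`). -/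
def IsArcBtw {X : Type*} [TopologicalSpace X] (A : Set X) (a b : X) : Prop :=
  IsArcWith A a b ∨ (a = b ∧ A = {a})

/-- `A` is an arc, possibly degenerate (i.e. a single point). -/
def IsArcOrPoint {X : Type*} [TopologicalSpace X] (A : Set X) : Prop :=
  IsArc A ∨ ∃ x, A = {x}

/-- The composant of a point `x`: the union of all proper subcontinua containing `x`. -/
def composant {X : Type*} [TopologicalSpace X] (x : X) : Set X :=
  {y | ∃ A : Set X, IsCompact A ∧ IsConnected A ∧ A ≠ univ ∧ x ∈ A ∧ y ∈ A}

/-- `g` preserves the order along composants: for every composant `C` and every continuous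
bijection `φ` from `ℝ` (respectively from `[0,∞)`) onto `C`, the map `φ⁻¹ ∘ g ∘ φ` is strictly
increasing. -/
def PreservesCompOrder {X : Type*} [TopologicalSpace X] (g : X → X) : Prop :=
  ∀ x : X,
    (∀ φ : ℝ → X, Continuous φ → Injective φ → range φ = composant x →
      ∀ t t' u u' : ℝ, g (φ t) = φ u → g (φ t') = φ u' → t < t' → u < u') ∧
    (∀ φ : {r : ℝ // (0 : ℝ) ≤ r} → X, Continuous φ → Injective φ → range φ = composant x →
      ∀ t t' u u', g (φ t) = φ u → g (φ t') = φ u' → t < t' → u < u')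

/-- Two self-maps of `X` are isotopic if there is a continuous `H : X × [0,1] → X` joining them
through homeomorphisms. -/
def Isotopic {X : Type*} [TopologicalSpace X] (f g : X → X) : Prop :=
  ∃ H : X × unitInterval → X, Continuous H ∧ (∀ x, H (x, 0) = f x) ∧ (∀ x, H (x, 1) = g x) ∧
    ∀ t : unitInterval, IsHomeomorph fun x => H (x, t)

/-- The topological limsup of a sequence of subsets. -/
def setLimsup {X : Type*} [TopologicalSpace X] (D : ℕ → Set X) : Set X :=
  {y | ∃ φ : ℕ → ℕ, StrictMono φ ∧ ∃ z : ℕ → X, (∀ k, z k ∈ D (φ k)) ∧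
    Tendsto z atTop (𝓝 y)}

/-- The point `0̄ = (0,0,0,…)` of `K` (an endpoint of `K`). -/
def zeroPt (s : ℝ) (hs1 : Real.sqrt 2 < s) : invLim s := by
  refine ⟨fun _ => 0, fun n => ⟨le_refl 0, zero_le_one⟩, fun n => ?_⟩
  have hs0 : 0 ≤ s := le_of_lt (lt_of_le_of_lt (Real.sqrt_nonneg 2) hs1)
  simp [tent]
  exact hs0

namespace TentProof

variable {s : ℝ}

lemma tent_eq (h1 : 1 < s) (x : ℝ) : tent s x = s / 2 - s * |x - 1 / 2| := by
  unfold tent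
  rcases le_total x (1 / 2) with h | h
  · rw [abs_of_nonpos (by linarith), min_eq_left (by nlinarith)]; ring
  · rw [abs_of_nonneg (by linarith), min_eq_right (by nlinarith)]; ring

lemma tent_le_half (h1 : 1 < s) {x : ℝ} (h : x ≤ 1 / 2) : tent s x = s * x := by
  rw [tent_eq h1, abs_of_nonpos (by linarith)]; ring

lemma tent_ge_half (h1 : 1 < s) {x : ℝ} (h : 1 / 2 ≤ x) : tent s x = s * (1 - x) := by
  rw [tent_eq h1, abs_of_nonneg (by linarith)]; ring

lemma tent_le (h1 : 1 < s) (x : ℝ) : tent s x ≤ s / 2 := by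
  rw [tent_eq h1]; nlinarith [abs_nonneg (x - 1 / 2)]

lemma tent_lip (h1 : 1 < s) (x y : ℝ) : |tent s x - tent s y| ≤ s * |x - y| := by
  rw [tent_eq h1, tent_eq h1]
  have := abs_abs_sub_abs_le (x - 1 / 2) (y - 1 / 2)
  have e : s / 2 - s * |x - 1 / 2| - (s / 2 - s * |y - 1 / 2|)
      = - (s * (|x - 1 / 2| - |y - 1 / 2|)) := by ring
  rw [e, abs_neg, abs_mul, abs_of_pos (by linarith : 0 < s)]
  refine mul_le_mul_of_nonneg_left ?_ (by linarith)
  simpa using this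

lemma tent_iter_lip (h1 : 1 < s) (k : ℕ) (x y : ℝ) :
    |(tent s)^[k] x - (tent s)^[k] y| ≤ s ^ k * |x - y| := by
  induction k generalizing x y with
  | zero => simp
  | succ k ih =>
    rw [iterate_succ_apply, iterate_succ_apply]
    refine (ih _ _).trans ?_
    rw [pow_succ, mul_assoc]
    exact mul_le_mul_of_nonneg_left (tent_lip h1 x y) (by positivity)

lemma tent_continuous (s : ℝ) : Continuous (tent s) := by
  unfold tent; fun_prop

open Classical in
/-- The zigzag function: first coordinate along the ray. -/
def rayF (s t : ℝ) : ℝ :=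
  if h : ∃ n : ℕ, t ≤ s ^ n / 2 then (tent s)^[Nat.find h] (t / s ^ (Nat.find h)) else 0

lemma exists_pow_ge (h1 : 1 < s) (t : ℝ) : ∃ n : ℕ, t ≤ s ^ n := by
  obtain ⟨n, hn⟩ := pow_unbounded_of_one_lt t h1
  exact ⟨n, hn.le⟩

lemma exists_pow_half (h1 : 1 < s) (t : ℝ) : ∃ n : ℕ, t ≤ s ^ n / 2 := by
  obtain ⟨n, hn⟩ := pow_unbounded_of_one_lt (2 * t) h1
  exact ⟨n, by linarith⟩

lemma rayF_eq (h1 : 1 < s) {t : ℝ} {k : ℕ} (hk : t ≤ s ^ k / 2) :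
    rayF s t = (tent s)^[k] (t / s ^ k) := by
  classical
  have hex : ∃ n : ℕ, t ≤ s ^ n / 2 := ⟨k, hk⟩
  unfold rayF
  rw [dif_pos hex]
  have hle : Nat.find hex ≤ k := Nat.find_min' hex hk
  have hsp := Nat.find_spec hex
  generalize Nat.find hex = n at hle hsp
  clear hex hk
  induction k, hle using Nat.le_induction with
  | base => rfl
  | succ m hm ih =>
    rw [ih, iterate_succ_apply]
    congr 1
    have hp : (0 : ℝ) < s ^ m := by positivity
    have hmn : s ^ n ≤ s ^ m := pow_le_pow_right₀ h1.le hm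
    rw [tent_le_half h1]
    · rw [pow_succ]; field_simp
    · rw [div_le_iff₀ (by positivity), pow_succ]
      nlinarith

lemma rayF_id (h1 : 1 < s) {t : ℝ} (ht : t ≤ s / 2) : rayF s t = t := by
  rw [rayF_eq h1 (k := 1) (by simpa using ht)]
  have hs : 0 < s := by linarith
  simp only [iterate_one, pow_one]
  rw [tent_le_half h1 (by rw [div_le_iff₀ hs]; linarith)]
  field_simp

lemma rayF_scale (h1 : 1 < s) (t : ℝ) : rayF s (s * t) = tent s (rayF s t) := by
  obtain ⟨k, hk⟩ := exists_pow_half h1 t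
  rw [rayF_eq h1 hk, rayF_eq h1 (t := s * t) (k := k + 1)]
  · rw [← iterate_succ_apply' (tent s) k, pow_succ]
    rw [mul_comm s t, mul_div_mul_right _ _ (by linarith)]
  · rw [pow_succ]; nlinarith

lemma rayF_lip (h1 : 1 < s) (t t' : ℝ) : |rayF s t - rayF s t'| ≤ |t - t'| := by
  obtain ⟨k, hk⟩ := exists_pow_half h1 (max t t')
  rw [rayF_eq h1 ((le_max_left _ _).trans hk), rayF_eq h1 ((le_max_right _ _).trans hk)]
  refine (tent_iter_lip h1 k _ _).trans ?_
  have hp : (0 : ℝ) < s ^ k := by positivity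
  rw [← sub_div, abs_div, abs_of_pos hp]
  rw [mul_div_cancel₀ _ hp.ne']

lemma rayF_iter (h1 : 1 < s) (t : ℝ) (j k : ℕ) :
    (tent s)^[k] (rayF s (t / s ^ (j + k))) = rayF s (t / s ^ j) := by
  induction k with
  | zero => simp
  | succ k ih =>
    rw [iterate_succ_apply, ← rayF_scale h1, ← ih]
    congr 2
    have hs : s ≠ 0 := by linarith
    rw [← add_assoc, pow_succ]
    field_simp

lemma rayF_succ (h1 : 1 < s) (t : ℝ) (j : ℕ) :
    tent s (rayF s (t / s ^ (j + 1))) = rayF s (t / s ^ j) := rayF_iter h1 t j 1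

/-- closeness to the critical point at a deep level gives closeness to the critical orbit. -/
lemma near_crit (h1 : 1 < s) (t : ℝ) {i j : ℕ} (hij : i ≤ j) :
    |rayF s (t / s ^ i) - (tent s)^[j - i] (1 / 2)| * s ^ i
      ≤ |rayF s (t / s ^ j) - 1 / 2| * s ^ j := by
  have := tent_iter_lip h1 (j - i) (rayF s (t / s ^ j)) (1 / 2)
  have e := rayF_iter h1 t i (j - i)
  rw [Nat.add_sub_cancel' hij] at e
  rw [e] at this
  have hp : (0 : ℝ) < s ^ i := by positivity
  calc _ ≤ (s ^ (j - i) * |rayF s (t / s ^ j) - 1 / 2|) * s ^ i :=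
        mul_le_mul_of_nonneg_right this hp.le
    _ = |rayF s (t / s ^ j) - 1 / 2| * (s ^ i * s ^ (j - i)) := by ring
    _ = _ := by rw [← pow_add, Nat.add_sub_cancel' hij]

/-- quantitative non-recurrence. -/
def NR (s ε : ℝ) : Prop := 0 < ε ∧ ∀ n, 1 ≤ n → ε ≤ |(tent s)^[n] (1 / 2) - 1 / 2|

lemma NR.le (h1 : 1 < s) {ε : ℝ} (h : NR s ε) : ε ≤ (s - 1) / 2 := by
  have := h.2 1 le_rfl
  rw [iterate_one, tent_le_half h1 le_rfl, abs_of_pos (by linarith)] at this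
  linarith

lemma zoneT (h1 : 1 < s) {ε : ℝ} (h : NR s ε) (k : ℕ) (x : ℝ)
    (hx : |(tent s)^[k] x - 1 / 2| < ε) :
    ∃ p σ : ℝ, (σ = 1 ∨ σ = -1) ∧ |x - p| * s ^ k < ε ∧
      ∀ v, |v| * s ^ k < ε → (tent s)^[k] (p + v) = 1 / 2 + σ * s ^ k * v := by
  induction k generalizing x with
  | zero => exact ⟨1 / 2, 1, Or.inl rfl, by simpa using hx, by intro v _; simp⟩
  | succ k ih =>
    rw [iterate_succ_apply] at hx
    obtain ⟨p, σ, hσ, hxp, hlin⟩ := ih _ hx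
    have hs : 0 < s := by linarith
    have hk : 0 < s ^ k := by positivity
    have key : ∀ v, |v| * s ^ k < ε → p + v ≤ s / 2 := by
      intro v hv
      by_contra hcon
      push Not at hcon
      have hT := tent_le h1 x
      have hb : |s / 2 - p| * s ^ k < ε := by
        rcases le_total (s / 2) p with hp | hp
        · refine lt_of_le_of_lt (mul_le_mul_of_nonneg_right ?_ hk.le) hxp
          rw [abs_of_nonpos (by linarith), abs_of_nonpos (by linarith)]; linarith
        · refine lt_of_le_of_lt (mul_le_mul_of_nonneg_right ?_ hk.le) hv
          rw [abs_of_nonneg (by linarith)]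
          exact le_trans (by linarith) (le_abs_self v)
      have e := hlin _ hb
      have e2 : (tent s)^[k + 1] (1 / 2) = (tent s)^[k] (p + (s / 2 - p)) := by
        rw [iterate_succ_apply, tent_le_half h1 le_rfl]; congr 1; ring
      have := h.2 (k + 1) (by omega)
      rw [e2, e] at this
      have e3 : |1 / 2 + σ * s ^ k * (s / 2 - p) - 1 / 2| = |s / 2 - p| * s ^ k := by
        rcases hσ with rfl | rfl
        · rw [show 1 / 2 + 1 * s ^ k * (s / 2 - p) - 1 / 2 = (s / 2 - p) * s ^ k by ring, abs_mul,
            abs_of_pos hk]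
        · rw [show 1 / 2 + -1 * s ^ k * (s / 2 - p) - 1 / 2 = - ((s / 2 - p) * s ^ k) by ring,
            abs_neg, abs_mul, abs_of_pos hk]
      linarith
    rcases le_total x (1 / 2) with hx2 | hx2
    · refine ⟨p / s, σ, hσ, ?_, ?_⟩
      · rw [tent_le_half h1 hx2] at hxp
        rw [pow_succ]
        have : |x - p / s| * s = |s * x - p| := by
          rw [← abs_of_pos hs, ← abs_mul, abs_of_pos hs]; congr 1; field_simp
        calc _ = (|x - p / s| * s) * s ^ k := by ring
          _ < ε := by rw [this]; exact hxp
      · intro v hv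
        have hv' : |s * v| * s ^ k < ε := by
          rw [abs_mul, abs_of_pos hs]; rw [pow_succ] at hv; linarith
        have hle := key _ hv'
        rw [iterate_succ_apply, tent_le_half h1]
        · rw [show s * (p / s + v) = p + s * v by field_simp, hlin _ hv']; ring
        · rw [show p / s + v = (p + s * v) / s by field_simp, div_le_iff₀ hs]; linarith
    · refine ⟨1 - p / s, -σ, by rcases hσ with rfl | rfl <;> simp, ?_, ?_⟩
      · rw [tent_ge_half h1 hx2] at hxp
        rw [pow_succ]
        have : |x - (1 - p / s)| * s = |s * (1 - x) - p| := by
          rw [← abs_of_pos hs, ← abs_mul, abs_of_pos hs, ← abs_neg]; congr 1; field_simp; ring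
        calc _ = (|x - (1 - p / s)| * s) * s ^ k := by ring
          _ < ε := by rw [this]; exact hxp
      · intro v hv
        have hv' : |-(s * v)| * s ^ k < ε := by
          rw [abs_neg, abs_mul, abs_of_pos hs]; rw [pow_succ] at hv; linarith
        have hle := key _ hv'
        rw [iterate_succ_apply, tent_ge_half h1]
        · rw [show s * (1 - (1 - p / s + v)) = p + -(s * v) by field_simp; ring, hlin _ hv']; ring
        · have : p / s - v ≤ 1 / 2 := by
            rw [show p / s - v = (p + -(s * v)) / s by field_simp; ring, div_le_iff₀ hs]; linarith
          linarith

/-- near a crossing of `1/2`, the zigzag is affine with slope `±1`. -/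
lemma zone (h1 : 1 < s) {ε : ℝ} (h : NR s ε) {t : ℝ} (ht : |rayF s t - 1 / 2| < ε) :
    ∃ p σ : ℝ, (σ = 1 ∨ σ = -1) ∧ |t - p| = |rayF s t - 1 / 2| ∧
      ∀ y, |y - p| < ε → rayF s y = 1 / 2 + σ * (y - p) := by
  obtain ⟨k, hk⟩ := exists_pow_half h1 (t + 2 * ε)
  have hε := h.1
  have hp : 0 < s ^ k := by positivity
  rw [rayF_eq h1 (by linarith : t ≤ s ^ k / 2)] at ht
  obtain ⟨p, σ, hσ, hxp, hlin⟩ := zoneT h1 h k _ ht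
  have e0 : |t - s ^ k * p| = |t / s ^ k - p| * s ^ k := by
    rw [← abs_of_pos hp, ← abs_mul, abs_of_pos hp]; congr 1; field_simp
  have hlin' : ∀ y, |y - s ^ k * p| < ε → rayF s y = 1 / 2 + σ * (y - s ^ k * p) := by
    intro y hy
    have a1 := abs_lt.1 hy
    have a2 : |t - s ^ k * p| < ε := by rw [e0]; exact hxp
    have a3 := abs_lt.1 a2
    rw [rayF_eq h1 (by linarith : y ≤ s ^ k / 2)]
    have := hlin (y / s ^ k - p) (by
      rw [← abs_of_pos hp, ← abs_mul, abs_of_pos hp]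
      rw [show (y / s ^ k - p) * s ^ k = y - s ^ k * p by rw [sub_mul, div_mul_cancel₀ _ hp.ne']; ring]
      exact hy)
    rw [show p + (y / s ^ k - p) = y / s ^ k by ring] at this
    rw [this, show σ * s ^ k * (y / s ^ k - p) = σ * (y / s ^ k * s ^ k - s ^ k * p) by ring,
      div_mul_cancel₀ _ hp.ne']
  refine ⟨s ^ k * p, σ, hσ, ?_, hlin'⟩
  rw [hlin' t (by rw [e0]; exact hxp)]
  rcases hσ with rfl | rfl
  · congr 1; ring
  · rw [← abs_neg]; congr 1; ring

/-- interval version -/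
lemma zone_interval (h1 : 1 < s) {ε : ℝ} (h : NR s ε) {x y : ℝ} (hxy : x ≤ y)
    (hf : ∀ t, x ≤ t → t ≤ y → |rayF s t - 1 / 2| ≤ ε / 2) :
    ∃ p σ : ℝ, (σ = 1 ∨ σ = -1) ∧
      ∀ t, x ≤ t → t ≤ y → rayF s t = 1 / 2 + σ * (t - p) := by
  have hε := h.1
  have hx := hf x le_rfl hxy
  obtain ⟨p, σ, hσ, hxp, hlin⟩ := zone h1 h (by linarith : |rayF s x - 1 / 2| < ε)
  rw [← hxp] at hx
  have hx' := abs_le.1 hx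
  refine ⟨p, σ, hσ, fun t h3 h4 => hlin t ?_⟩
  have : y < p + ε := by
    by_contra hcon
    push Not at hcon
    have b := hf (p + 3 * ε / 4) (by linarith) (by linarith)
    rw [hlin _ (by rw [abs_lt]; constructor <;> linarith)] at b
    have b' := abs_le.1 b
    rcases hσ with rfl | rfl <;> linarith
  rw [abs_lt]; constructor <;> linarith

/-- Two distinct folds are far apart; here in the form of avoidance. -/
def Good (s δ y : ℝ) : Prop := ∀ i : ℕ, 1 ≤ i → 2 * δ / s ^ i ≤ |rayF s (y / s ^ i) - 1 / 2|

lemma avoid_aux (h1 : 1 < s) {ε : ℝ} (h : NR s ε) {y y' η η' : ℝ} {i j : ℕ} (hij : i < j)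
    (hi : |rayF s (y / s ^ i) - 1 / 2| * s ^ i ≤ η)
    (hj : |rayF s (y' / s ^ j) - 1 / 2| * s ^ j ≤ η') :
    ε * s ^ i ≤ η + η' + |y - y'| := by
  have a := (near_crit h1 y' hij.le).trans hj
  have b := h.2 (j - i) (by omega)
  have c := rayF_lip h1 (y / s ^ i) (y' / s ^ i)
  have hp : 0 < s ^ i := by positivity
  rw [← sub_div, abs_div, abs_of_pos hp, le_div_iff₀ hp] at c
  have d : |(tent s)^[j - i] (1 / 2) - 1 / 2| ≤
      |rayF s (y' / s ^ i) - (tent s)^[j - i] (1 / 2)| + |rayF s (y / s ^ i) - rayF s (y' / s ^ i)|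
        + |rayF s (y / s ^ i) - 1 / 2| := by
    have e1 := abs_sub_le ((tent s)^[j - i] (1 / 2)) (rayF s (y' / s ^ i)) (1 / 2)
    have e2 := abs_sub_le (rayF s (y' / s ^ i)) (rayF s (y / s ^ i)) (1 / 2)
    rw [abs_sub_comm ((tent s)^[j - i] (1 / 2)) (rayF s (y' / s ^ i))] at e1
    rw [abs_sub_comm (rayF s (y' / s ^ i)) (rayF s (y / s ^ i))] at e2
    linarith
  nlinarith

lemma avoid (h1 : 1 < s) {ε δ : ℝ} (h : NR s ε) (hδ : 0 < δ) (hδε : 20 * δ ≤ ε) (y : ℝ) :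
    Good s δ y ∨ Good s δ (y - 5 * δ) := by
  by_contra hcon
  push Not at hcon
  obtain ⟨g1, g2⟩ := hcon
  unfold Good at g1 g2
  push Not at g1 g2
  obtain ⟨i, hi, gi⟩ := g1
  obtain ⟨j, hj, gj⟩ := g2
  have hpi : 1 ≤ s ^ i := one_le_pow₀ h1.le
  have hpj : 1 ≤ s ^ j := one_le_pow₀ h1.le
  rw [lt_div_iff₀ (by linarith)] at gi gj
  have hε := h.1
  rcases lt_trichotomy i j with hij | hij | hij
  · have := avoid_aux h1 h hij gi.le gj.le
    rw [show y - (y - 5 * δ) = 5 * δ by ring, abs_of_pos (by linarith)] at this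
    nlinarith
  · subst hij
    have g0 : |rayF s (y / s ^ i) - 1 / 2| < 2 * δ := by
      nlinarith [abs_nonneg (rayF s (y / s ^ i) - 1 / 2)]
    obtain ⟨p, σ, hσ, hxp, hlin⟩ := zone h1 h (t := y / s ^ i) (by linarith)
    rw [← hxp] at gi g0
    have e1 : (y - 5 * δ) / s ^ i - p = (y / s ^ i - p) - 5 * δ / s ^ i := by ring
    have q : 5 * δ / s ^ i ≤ 5 * δ := div_le_self (by linarith) hpi
    have q0 : 0 < 5 * δ / s ^ i := by positivity
    have q1 := abs_lt.1 g0
    have e2 := hlin ((y - 5 * δ) / s ^ i) (by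
      rw [e1, abs_lt]; constructor <;> linarith)
    rw [e2] at gj
    have e3 : |1 / 2 + σ * ((y - 5 * δ) / s ^ i - p) - 1 / 2| = |(y / s ^ i - p) - 5 * δ / s ^ i| := by
      rw [e1]
      rcases hσ with rfl | rfl
      · congr 1; ring
      · rw [← abs_neg]; congr 1; ring
    rw [e3] at gj
    have t1 := abs_sub_abs_le_abs_sub (5 * δ / s ^ i) (y / s ^ i - p)
    rw [abs_of_pos q0, abs_sub_comm (5 * δ / s ^ i) (y / s ^ i - p)] at t1
    have e4 : 5 * δ / s ^ i * s ^ i = 5 * δ := by field_simp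
    nlinarith
  · have := avoid_aux h1 h hij gj.le gi.le
    rw [show (y - 5 * δ) - y = -(5 * δ) by ring, abs_neg, abs_of_pos (by linarith)] at this
    nlinarith


/-- sign constancy lemma -/
lemma sign_const {X Y : ℝ → ℝ} {u1 u2 e : ℝ} (he : 0 < e) (h12 : u1 ≤ u2)
    (hX : ContinuousOn X (Icc u1 u2)) (hY : ContinuousOn Y (Icc u1 u2))
    (h5 : ∀ u ∈ Icc u1 u2, |(|X u| - |Y u|)| ≤ 5 * e)
    (h6 : ∀ u ∈ Icc u1 u2, |X u| ≤ 6 * e → |(|X u| - |Y u|)| ≤ e)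
    (mX : ∀ v1 v2, u1 ≤ v1 → v1 < v2 → v2 ≤ u2 → (∀ u ∈ Icc v1 v2, |X u| ≤ 3 * e) →
      StrictMonoOn X (Icc v1 v2) ∨ StrictAntiOn X (Icc v1 v2))
    (mY : ∀ v1 v2, u1 ≤ v1 → v1 < v2 → v2 ≤ u2 → (∀ u ∈ Icc v1 v2, |Y u| ≤ 3 * e) →
      StrictMonoOn Y (Icc v1 v2) ∨ StrictAntiOn Y (Icc v1 v2))
    (hu1 : 2 * e ≤ |X u1|) (hu2 : 2 * e ≤ |X u2|) :
    0 < (X u1 * Y u1) * (X u2 * Y u2) := by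
  have hYge : ∀ u ∈ Icc u1 u2, 2 * e ≤ |X u| → e ≤ |Y u| := by
    intro u hu hxu
    by_cases hc : |X u| ≤ 6 * e
    · have := (abs_le.1 (h6 u hu hc)).2; linarith
    · have := (abs_le.1 (h5 u hu)).2; linarith
  have hne : ∀ u ∈ Icc u1 u2, 2 * e ≤ |X u| → X u * Y u ≠ 0 := by
    intro u hu hxu
    have := hYge u hu hxu
    refine mul_ne_zero ?_ ?_
    · intro h; rw [h, abs_zero] at hxu; linarith
    · intro h; rw [h, abs_zero] at this; linarith
  have m1 : u1 ∈ Icc u1 u2 := left_mem_Icc.2 h12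
  have m2 : u2 ∈ Icc u1 u2 := right_mem_Icc.2 h12
  have n1 := hne u1 m1 hu1
  by_contra hcon
  push Not at hcon
  set Q : ℝ → ℝ := fun u => (X u1 * Y u1) * (X u * Y u) with hQ
  have hQc : ContinuousOn Q (Icc u1 u2) := continuousOn_const.mul (hX.mul hY)
  have hXa : ContinuousOn (fun u => |X u|) (Icc u1 u2) := hX.abs
  have hQne : ∀ u ∈ Icc u1 u2, 2 * e ≤ |X u| → Q u ≠ 0 :=
    fun u hu hxu => mul_ne_zero n1 (hne u hu hxu)
  have cl : ∀ w ∈ Icc u1 u2, ∀ q : Set ℝ, IsClosed q →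
      IsCompact (Icc u1 w ∩ ((fun u => |X u|) ⁻¹' (Ici (2 * e))) ∩ (Q ⁻¹' q)) := by
    intro w hw q hq
    have hsub : Icc u1 w ⊆ Icc u1 u2 := Icc_subset_Icc_right hw.2
    have c1 : IsClosed (Icc u1 w ∩ ((fun u => |X u|) ⁻¹' (Ici (2 * e)))) :=
      (hXa.mono hsub).preimage_isClosed_of_isClosed isClosed_Icc isClosed_Ici
    have c2 : IsClosed (Icc u1 w ∩ (Q ⁻¹' q)) :=
      (hQc.mono hsub).preimage_isClosed_of_isClosed isClosed_Icc hq
    refine isCompact_Icc.of_isClosed_subset (s := Icc u1 w) ?_ (fun u hu => hu.1.1)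
    convert c1.inter c2 using 1
    ext u; simp only [mem_inter_iff]; tauto
  obtain ⟨v2, hv2, hv2l⟩ := (cl u2 m2 (Iic 0) isClosed_Iic).exists_isLeast
    ⟨u2, ⟨m2, hu2⟩, hcon⟩
  have hv2m : v2 ∈ Icc u1 u2 := hv2.1.1
  have hQ1 : 0 < Q u1 := mul_self_pos.2 n1
  obtain ⟨v1, hv1, hv1l⟩ := (cl v2 hv2m (Ici 0) isClosed_Ici).exists_isGreatest
    ⟨u1, ⟨left_mem_Icc.2 hv2m.1, hu1⟩, hQ1.le⟩
  have hv1m : v1 ∈ Icc u1 u2 := ⟨hv1.1.1.1, hv1.1.1.2.trans hv2m.2⟩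
  have q1 : 0 < Q v1 := lt_of_le_of_ne hv1.2 (hQne v1 hv1m hv1.1.2).symm
  have q2 : Q v2 < 0 := lt_of_le_of_ne hv2.2 (hQne v2 hv2m hv2.1.2)
  have hlt : v1 < v2 := by
    refine lt_of_le_of_ne hv1.1.1.2 ?_
    rintro h; rw [h] at q1; linarith
  have hsub : Icc v1 v2 ⊆ Icc u1 u2 := Icc_subset_Icc hv1m.1 hv2m.2
  have hin : ∀ u ∈ Ioo v1 v2, |X u| ≤ 2 * e := by
    intro u hu
    by_contra hc
    push Not at hc
    rcases le_total (Q u) 0 with hq | hq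
    · have := hv2l ⟨⟨⟨hv1m.1.trans hu.1.le, hu.2.le.trans hv2m.2⟩, hc.le⟩, hq⟩
      linarith [hu.2]
    · have := hv1l ⟨⟨⟨hv1m.1.trans hu.1.le, hu.2.le⟩, hc.le⟩, hq⟩
      linarith [hu.1]
  have hin2 : ∀ u ∈ Icc v1 v2, |X u| ≤ 2 * e := by
    intro u hu
    have hcl := closure_Ioo hlt.ne
    refine le_on_closure (s := Ioo v1 v2) (f := fun u => |X u|) (g := fun _ => 2 * e) hin ?_ ?_ ?_
    · rw [hcl]; exact hXa.mono hsub
    · exact continuousOn_const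
    · rw [hcl]; exact hu
  have e6 : ∀ u ∈ Icc v1 v2, |(|X u| - |Y u|)| ≤ e :=
    fun u hu => h6 u (hsub hu) (by linarith [hin2 u hu])
  have hinY : ∀ u ∈ Icc v1 v2, |Y u| ≤ 3 * e := by
    intro u hu
    have := (abs_le.1 (e6 u hu)).1
    linarith [hin2 u hu]
  obtain ⟨u0, hu0, hQ0⟩ : ∃ u0 ∈ Icc v1 v2, Q u0 = 0 := by
    have := intermediate_value_Icc' hlt.le (hQc.mono hsub) (show (0 : ℝ) ∈ Icc _ _ from ⟨q2.le, q1.le⟩)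
    exact this
  have hu01 : v1 < u0 := lt_of_le_of_ne hu0.1 (by rintro h; rw [h] at q1; linarith)
  have hu02 : u0 < v2 := lt_of_le_of_ne hu0.2 (by rintro h; rw [← h] at q2; linarith)
  have hY0 : |Y u0| ≤ e := by
    have := (mul_eq_zero.1 hQ0).resolve_left n1
    rcases mul_eq_zero.1 this with hz | hz
    · have := (abs_le.1 (e6 u0 hu0)).1
      rw [hz, abs_zero] at this; linarith
    · rw [hz, abs_zero]; exact he.le
  have mv1 : v1 ∈ Icc v1 v2 := left_mem_Icc.2 hlt.le
  have mv2 : v2 ∈ Icc v1 v2 := right_mem_Icc.2 hlt.le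
  have x1 : |X v1| = 2 * e := le_antisymm (hin2 _ mv1) hv1.1.2
  have x2 : |X v2| = 2 * e := le_antisymm (hin2 _ mv2) hv2.1.2
  have xne : X v1 ≠ X v2 := by
    rcases mX v1 v2 hv1m.1 hlt hv2m.2 (fun u hu => by linarith [hin2 u hu]) with hm | hm
    · exact (hm mv1 mv2 hlt).ne
    · exact (hm mv1 mv2 hlt).ne'
  have xneg : X v1 * X v2 < 0 := by
    rcases (abs_eq (by linarith)).1 x1 with a | a <;> rcases (abs_eq (by linarith)).1 x2 with b | b
    · exact absurd (a.trans b.symm) xne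
    · rw [a, b]; nlinarith
    · rw [a, b]; nlinarith
    · exact absurd (a.trans b.symm) xne
  have y1 := hYge v1 hv1m hv1.1.2
  have y2 := hYge v2 hv2m hv2.1.2
  have yb := abs_le.1 hY0
  have yneg : Y v1 * Y v2 < 0 := by
    rcases mY v1 v2 hv1m.1 hlt hv2m.2 hinY with hm | hm
    · have a := hm mv1 hu0 hu01
      have b := hm hu0 mv2 hu02
      rcases le_abs.1 y1 with c | c
      · linarith
      rcases le_abs.1 y2 with d | d
      · nlinarith
      · linarith
    · have a := hm mv1 hu0 hu01
      have b := hm hu0 mv2 hu02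
      rcases le_abs.1 y2 with c | c
      · linarith
      rcases le_abs.1 y1 with d | d
      · nlinarith
      · linarith
  have fin1 : 0 < (X v1 * X v2) * (Y v1 * Y v2) := mul_pos_of_neg_of_neg xneg yneg
  have fin2 : Q v1 * Q v2 < 0 := mul_neg_of_pos_of_neg q1 q2
  have fin3 : Q v1 * Q v2 = (X u1 * Y u1) ^ 2 * ((X v1 * X v2) * (Y v1 * Y v2)) := by
    simp only [hQ]; ring
  have : 0 ≤ (X u1 * Y u1) ^ 2 * ((X v1 * X v2) * (Y v1 * Y v2)) := by positivity
  linarith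

lemma zone_mono (h1 : 1 < s) {ε : ℝ} (h : NR s ε) {g : ℝ → ℝ} {v1 v2 : ℝ} (hv : v1 < v2)
    (hg : ContinuousOn g (Icc v1 v2))
    (hm : StrictMonoOn g (Icc v1 v2) ∨ StrictAntiOn g (Icc v1 v2))
    (hf : ∀ u ∈ Icc v1 v2, |rayF s (g u) - 1 / 2| ≤ ε / 2) :
    StrictMonoOn (fun u => rayF s (g u) - 1 / 2) (Icc v1 v2) ∨
      StrictAntiOn (fun u => rayF s (g u) - 1 / 2) (Icc v1 v2) := by
  have mv1 : v1 ∈ Icc v1 v2 := left_mem_Icc.2 hv.le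
  have mv2 : v2 ∈ Icc v1 v2 := right_mem_Icc.2 hv.le
  rcases hm with hm | hm
  · obtain ⟨p, σ, hσ, hl⟩ := zone_interval h1 h (hm mv1 mv2 hv).le (by
      intro t ht1 ht2
      obtain ⟨u, hu, rfl⟩ := intermediate_value_Icc hv.le hg ⟨ht1, ht2⟩
      exact hf u hu)
    have hl' : ∀ u ∈ Icc v1 v2, rayF s (g u) = 1 / 2 + σ * (g u - p) := fun u hu =>
      hl _ (hm.monotoneOn mv1 hu hu.1) (hm.monotoneOn hu mv2 hu.2)
    rcases hσ with rfl | rfl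
    · left; intro x hx y hy hxy
      have := hm hx hy hxy
      simp only; rw [hl' x hx, hl' y hy]; linarith
    · right; intro x hx y hy hxy
      have := hm hx hy hxy
      simp only; rw [hl' x hx, hl' y hy]; linarith
  · obtain ⟨p, σ, hσ, hl⟩ := zone_interval h1 h (hm mv1 mv2 hv).le (by
      intro t ht1 ht2
      obtain ⟨u, hu, rfl⟩ := intermediate_value_Icc' hv.le hg ⟨ht1, ht2⟩
      exact hf u hu)
    have hl' : ∀ u ∈ Icc v1 v2, rayF s (g u) = 1 / 2 + σ * (g u - p) := fun u hu =>
      hl _ (hm.antitoneOn hu mv2 hu.2) (hm.antitoneOn mv1 hu hu.1)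
    rcases hσ with rfl | rfl
    · right; intro x hx y hy hxy
      have := hm hx hy hxy
      simp only; rw [hl' x hx, hl' y hy]; linarith
    · left; intro x hx y hy hxy
      have := hm hx hy hxy
      simp only; rw [hl' x hx, hl' y hy]; linarith

lemma rayF_continuous (h1 : 1 < s) : Continuous (rayF s) := by
  refine (LipschitzWith.of_dist_le_mul (K := 1) ?_).continuous
  intro x y
  simpa [Real.dist_eq] using rayF_lip h1 x y

/-- Core lemma. -/
lemma core (h1 : 1 < s) {ε δ : ℝ} (h : NR s ε) (hδ : 0 < δ) (hδε : 20 * δ ≤ ε)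
    {a b : ℝ → ℝ} {r : ℝ} (hr : 0 ≤ r)
    (ha : ContinuousOn a (Icc 0 r)) (hb : ContinuousOn b (Icc 0 r))
    (hma : StrictMonoOn a (Icc 0 r)) (hmb : StrictAntiOn b (Icc 0 r))
    (hab0 : a 0 = b 0)
    (h0 : ∀ u ∈ Icc 0 r, |rayF s (a u) - rayF s (b u)| ≤ δ)
    (hab : δ < a r - b r) (hg : Good s δ (a r)) :
    ∃ l : ℕ, 1 ≤ l ∧
      (∀ j < l, |rayF s (a r / s ^ j) - rayF s (b r / s ^ j)| ≤ δ / s ^ j) ∧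
      |rayF s (a r / s ^ l) + rayF s (b r / s ^ l) - 1| ≤ δ / s ^ l ∧
      |rayF s (a 0 / s ^ l) - 1 / 2| ≤ 2 * δ / s ^ l := by
  classical
  have hs : 0 < s := by linarith
  let G : ℕ → ℝ → Prop := fun j u => ∀ i, 1 ≤ i → i ≤ j →
    2 * δ / s ^ i ≤ |rayF s (a u / s ^ i) - 1 / 2|
  let H : ℕ → Prop := fun j => ∀ u ∈ Icc 0 r,
    |rayF s (a u / s ^ j) - rayF s (b u / s ^ j)| ≤ 5 * (δ / s ^ j) ∧
    (G j u → |rayF s (a u / s ^ j) - rayF s (b u / s ^ j)| ≤ δ / s ^ j)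
  have mr : r ∈ Icc 0 r := right_mem_Icc.2 hr
  have m0 : (0 : ℝ) ∈ Icc 0 r := left_mem_Icc.2 hr
  have hGr : ∀ j, G j r := fun j i hi _ => hg i hi
  have hex : ∃ j, ¬ H j := by
    obtain ⟨j, hj⟩ := exists_pow_half h1 (a r)
    refine ⟨j, fun hH => ?_⟩
    have hp : 0 < s ^ j := by positivity
    have e := (hH r mr).2 (hGr j)
    have c1 : a r / s ^ j ≤ s / 2 := by rw [div_le_iff₀ hp]; nlinarith
    have c2 : b r / s ^ j ≤ s / 2 := by rw [div_le_iff₀ hp]; nlinarith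
    rw [rayF_id h1 c1, rayF_id h1 c2, ← sub_div] at e
    have := (le_abs_self _).trans e
    rw [div_le_div_iff_of_pos_right hp] at this
    linarith
  have hmin : ∀ j < Nat.find hex, H j := fun j hj => not_not.1 (Nat.find_min hex hj)
  have hspec := Nat.find_spec hex
  obtain ⟨k, hk⟩ : ∃ k, Nat.find hex = k + 1 := by
    refine Nat.exists_eq_succ_of_ne_zero ?_
    intro hz
    rw [hz] at hspec
    apply hspec
    intro u hu
    have := h0 u hu
    simp only [pow_zero, div_one]
    exact ⟨by linarith, fun _ => this⟩
  rw [hk] at hmin hspec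
  have hHk := hmin k (by omega)
  set X : ℝ → ℝ := fun u => rayF s (a u / s ^ (k + 1)) - 1 / 2 with hX
  set Y : ℝ → ℝ := fun u => rayF s (b u / s ^ (k + 1)) - 1 / 2 with hY
  set e := δ / s ^ (k + 1) with he
  have hpk : 0 < s ^ (k + 1) := by positivity
  have hpk1 : 1 ≤ s ^ (k + 1) := one_le_pow₀ h1.le
  have he0 : 0 < e := by positivity
  have heδ : e ≤ δ := div_le_self hδ.le hpk1
  have hek : δ / s ^ k = s * e := by rw [he, pow_succ]; field_simp
  have hXY : ∀ u, |rayF s (a u / s ^ k) - rayF s (b u / s ^ k)| = s * |(|X u| - |Y u|)| := by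
    intro u
    rw [← rayF_succ h1, ← rayF_succ h1 (b u), tent_eq h1, tent_eq h1]
    have : ∀ p q : ℝ, s / 2 - s * p - (s / 2 - s * q) = -(s * (p - q)) := by intro p q; ring
    rw [this, abs_neg, abs_mul, abs_of_pos hs]
  have h5 : ∀ u ∈ Icc 0 r, |(|X u| - |Y u|)| ≤ 5 * e := by
    intro u hu
    have := (hHk u hu).1
    rw [hXY, hek] at this
    have : s * |(|X u| - |Y u|)| ≤ s * (5 * e) := by linarith
    exact le_of_mul_le_mul_left this hs
  have hGk : ∀ u ∈ Icc 0 r, G k u → |(|X u| - |Y u|)| ≤ e := by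
    intro u hu hG
    have := (hHk u hu).2 hG
    rw [hXY, hek] at this
    exact le_of_mul_le_mul_left this hs
  have hXG : ∀ u, |X u| ≤ 6 * e → G k u := by
    intro u hu i hi hik
    have hpi : 1 ≤ s ^ i := one_le_pow₀ h1.le
    have nc := near_crit h1 (a u) (show i ≤ k + 1 by omega)
    have c1 : |rayF s (a u / s ^ (k + 1)) - 1 / 2| * s ^ (k + 1) ≤ 6 * δ := by
      calc _ ≤ (6 * e) * s ^ (k + 1) := mul_le_mul_of_nonneg_right hu hpk.le
        _ = 6 * δ := by rw [he]; field_simp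
    have c2 : |rayF s (a u / s ^ i) - (tent s)^[k + 1 - i] (1 / 2)| ≤ 6 * δ := by
      have := nc.trans c1
      nlinarith [abs_nonneg (rayF s (a u / s ^ i) - (tent s)^[k + 1 - i] (1 / 2))]
    have c3 := h.2 (k + 1 - i) (by omega)
    have c4 := abs_sub_le ((tent s)^[k + 1 - i] (1 / 2)) (rayF s (a u / s ^ i)) (1 / 2)
    rw [abs_sub_comm ((tent s)^[k + 1 - i] (1 / 2)) (rayF s (a u / s ^ i))] at c4
    have c5 : 2 * δ / s ^ i ≤ 2 * δ := div_le_self (by linarith) hpi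
    linarith
  have h6 : ∀ u ∈ Icc 0 r, |X u| ≤ 6 * e → |(|X u| - |Y u|)| ≤ e :=
    fun u hu hx => hGk u hu (hXG u hx)
  have hXc : ContinuousOn X (Icc 0 r) :=
    ((rayF_continuous h1).comp_continuousOn (ha.div_const _)).sub continuousOn_const
  have hYc : ContinuousOn Y (Icc 0 r) :=
    ((rayF_continuous h1).comp_continuousOn (hb.div_const _)).sub continuousOn_const
  have mX : ∀ v1 v2, 0 ≤ v1 → v1 < v2 → v2 ≤ r → (∀ u ∈ Icc v1 v2, |X u| ≤ 3 * e) →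
      StrictMonoOn X (Icc v1 v2) ∨ StrictAntiOn X (Icc v1 v2) := by
    intro v1 v2 hv1 hv hv2 hb3
    have hsub : Icc v1 v2 ⊆ Icc 0 r := Icc_subset_Icc hv1 hv2
    refine zone_mono h1 h hv ((ha.mono hsub).div_const _) (Or.inl ?_) ?_
    · intro x hx y hy hxy
      exact div_lt_div_of_pos_right (hma (hsub hx) (hsub hy) hxy) hpk
    · intro u hu; have := hb3 u hu; simp only [hX] at this; linarith
  have mY : ∀ v1 v2, 0 ≤ v1 → v1 < v2 → v2 ≤ r → (∀ u ∈ Icc v1 v2, |Y u| ≤ 3 * e) →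
      StrictMonoOn Y (Icc v1 v2) ∨ StrictAntiOn Y (Icc v1 v2) := by
    intro v1 v2 hv1 hv hv2 hb3
    have hsub : Icc v1 v2 ⊆ Icc 0 r := Icc_subset_Icc hv1 hv2
    refine zone_mono h1 h hv ((hb.mono hsub).div_const _) (Or.inr ?_) ?_
    · intro x hx y hy hxy
      exact div_lt_div_of_pos_right (hmb (hsub hx) (hsub hy) hxy) hpk
    · intro u hu; have := hb3 u hu; simp only [hY] at this; linarith
  have h2e : 2 * δ / s ^ (k + 1) = 2 * e := by rw [he]; ring
  have hXr : 2 * e ≤ |X r| := by rw [← h2e]; exact hg (k + 1) (by omega)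
  have sc : ∀ u ∈ Icc 0 r, 2 * e ≤ |X u| → 0 < (X u * Y u) * (X r * Y r) := by
    intro u hu hxu
    have hsub : Icc u r ⊆ Icc 0 r := Icc_subset_Icc_left hu.1
    exact sign_const he0 hu.2 (hXc.mono hsub) (hYc.mono hsub) (fun v hv => h5 v (hsub hv))
      (fun v hv => h6 v (hsub hv)) (fun v1 v2 a1 => mX v1 v2 (hu.1.trans a1))
      (fun v1 v2 a1 => mY v1 v2 (hu.1.trans a1)) hxu hXr
  have hsame : ∀ x y : ℝ, 0 < x * y → |x - y| = |(|x| - |y|)| := by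
    intro x y hxy
    rcases mul_pos_iff.1 hxy with ⟨p, q⟩ | ⟨p, q⟩
    · rw [abs_of_pos p, abs_of_pos q]
    · rw [abs_of_neg p, abs_of_neg q, ← abs_neg]; congr 1; ring
  have hopp : ∀ x y : ℝ, x * y < 0 → |x + y| = |(|x| - |y|)| := by
    intro x y hxy
    rcases mul_neg_iff.1 hxy with ⟨p, q⟩ | ⟨p, q⟩
    · rw [abs_of_pos p, abs_of_neg q]; congr 1; ring
    · rw [abs_of_neg p, abs_of_pos q, ← abs_neg]; congr 1; ring
  have hself := sc r mr hXr
  have hneg : X r * Y r < 0 := by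
    by_contra hcon
    push Not at hcon
    have hpos : 0 < X r * Y r := lt_of_le_of_ne hcon (by rintro hz; rw [← hz] at hself; linarith)
    apply hspec
    intro u hu
    have ediff : rayF s (a u / s ^ (k + 1)) - rayF s (b u / s ^ (k + 1)) = X u - Y u := by
      simp only [hX, hY]; ring
    rw [ediff]
    by_cases hc : 2 * e ≤ |X u|
    · have : 0 < X u * Y u := (mul_pos_iff_of_pos_right hpos).1 (sc u hu hc)
      rw [hsame _ _ this]
      exact ⟨h5 u hu, fun hG => hGk u hu (fun i hi hik => hG i hi (by omega))⟩
    · push Not at hc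
      have c6 := abs_le.1 (h6 u hu (by linarith))
      refine ⟨(abs_sub _ _).trans (by linarith), fun hG => ?_⟩
      have := hG (k + 1) (by omega) le_rfl
      rw [h2e] at this
      exact absurd this (not_le.2 hc)
  refine ⟨k + 1, by omega, ?_, ?_, ?_⟩
  · intro j hj
    exact (hmin j hj r mr).2 (hGr j)
  · have : rayF s (a r / s ^ (k + 1)) + rayF s (b r / s ^ (k + 1)) - 1 = X r + Y r := by
      simp only [hX, hY]; ring
    rw [this, hopp _ _ hneg]
    exact hGk r mr (hGr k)
  · rw [h2e]
    by_contra hcon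
    push Not at hcon
    have := sc 0 m0 hcon.le
    have e0 : Y 0 = X 0 := by simp only [hX, hY, hab0]
    rw [e0] at this
    nlinarith [mul_self_nonneg (X 0)]

lemma affine_or_fold (h1 : 1 < s) {x y : ℝ} (hxy : x < y) :
    (∃ p i, x < p ∧ p < y ∧ 1 ≤ i ∧ rayF s (p / s ^ i) = 1 / 2) ∨
    ∃ σ q : ℝ, (σ = 1 ∨ σ = -1) ∧ ∀ t, x ≤ t → t ≤ y → rayF s t = q + σ * t := by
  by_cases hf : ∃ p i, x < p ∧ p < y ∧ 1 ≤ i ∧ rayF s (p / s ^ i) = 1 / 2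
  · exact Or.inl hf
  right
  push Not at hf
  obtain ⟨k, hk⟩ := exists_pow_half h1 y
  have key : ∀ j, j ≤ k → ∃ σ q : ℝ, (σ = 1 ∨ σ = -1) ∧
      ∀ t, x ≤ t → t ≤ y → rayF s (t / s ^ (k - j)) = q + σ * (t / s ^ (k - j)) := by
    intro j
    induction j with
    | zero =>
      intro _
      refine ⟨1, 0, Or.inl rfl, fun t _ ht => ?_⟩
      have hp : 0 < s ^ k := by positivity
      rw [Nat.sub_zero, rayF_id h1]
      · ring
      · rw [div_le_iff₀ hp]; nlinarith
    | succ j ih =>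
      intro hj
      obtain ⟨σ, q, hσ, hl⟩ := ih (by omega)
      obtain ⟨m, hm⟩ : ∃ m, k - j = m + 1 := ⟨k - j - 1, by omega⟩
      have hm' : k - (j + 1) = m := by omega
      rw [hm] at hl
      rw [hm']
      have hp : 0 < s ^ (m + 1) := by positivity
      have hp' : 0 < s ^ m := by positivity
      have hcont : ContinuousOn (fun t => rayF s (t / s ^ (m + 1))) (Icc x y) :=
        ((rayF_continuous h1).comp (continuous_id.div_const _)).continuousOn
      have hside : (∀ t, x ≤ t → t ≤ y → rayF s (t / s ^ (m + 1)) ≤ 1 / 2) ∨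
          (∀ t, x ≤ t → t ≤ y → 1 / 2 ≤ rayF s (t / s ^ (m + 1))) := by
        by_contra hcon
        push Not at hcon
        obtain ⟨⟨t1, a1, b1, c1⟩, ⟨t2, a2, b2, c2⟩⟩ := hcon
        have : ∃ t ∈ uIcc t1 t2, rayF s (t / s ^ (m + 1)) = 1 / 2 := by
          have hsub : uIcc t1 t2 ⊆ Icc x y := uIcc_subset_Icc ⟨a1, b1⟩ ⟨a2, b2⟩
          have := intermediate_value_uIcc (hcont.mono hsub)
          exact this (mem_uIcc.2 (Or.inr ⟨c2.le, c1.le⟩))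
        obtain ⟨t, ht, hte⟩ := this
        have tb : x < t ∧ t < y := by
          have n1 : t ≠ t1 := by rintro rfl; linarith
          have n2 : t ≠ t2 := by rintro rfl; linarith
          rcases mem_uIcc.1 ht with ⟨p, q⟩ | ⟨p, q⟩
          · exact ⟨lt_of_le_of_lt a1 (lt_of_le_of_ne p n1.symm), lt_of_lt_of_le (lt_of_le_of_ne q n2) b2⟩
          · exact ⟨lt_of_le_of_lt a2 (lt_of_le_of_ne p n2.symm), lt_of_lt_of_le (lt_of_le_of_ne q n1) b1⟩
        exact hf t (m + 1) tb.1 tb.2 (by omega) hte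
      have hss : ∀ t : ℝ, s * (t / s ^ (m + 1)) = t / s ^ m := by
        intro t; rw [pow_succ]; field_simp
      rcases hside with hside | hside
      · refine ⟨σ, s * q, hσ, fun t ha hb => ?_⟩
        rw [← rayF_succ h1, tent_le_half h1 (hside t ha hb), hl t ha hb, ← hss]
        ring
      · refine ⟨-σ, s * (1 - q), by rcases hσ with rfl | rfl <;> simp, fun t ha hb => ?_⟩
        rw [← rayF_succ h1, tent_ge_half h1 (hside t ha hb), hl t ha hb, ← hss]
        ring
  obtain ⟨σ, q, hσ, hl⟩ := key k le_rfl
  refine ⟨σ, q, hσ, fun t ha hb => ?_⟩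
  have := hl t ha hb
  simpa using this

lemma fold_sep (h1 : 1 < s) {ε : ℝ} (h : NR s ε) {p q : ℝ} (hpq : p < q) {i j : ℕ}
    (hi : 1 ≤ i) (hj : 1 ≤ j) (hp : rayF s (p / s ^ i) = 1 / 2)
    (hq : rayF s (q / s ^ j) = 1 / 2) : ε ≤ q - p := by
  have hε := h.1
  have hpi : 1 ≤ s ^ i := one_le_pow₀ h1.le
  have hpj : 1 ≤ s ^ j := one_le_pow₀ h1.le
  rcases lt_trichotomy i j with hij | hij | hij
  · have := avoid_aux h1 h hij (y := p) (y' := q) (η := 0) (η' := 0) (by simp [hp]) (by simp [hq])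
    rw [abs_of_neg (by linarith)] at this
    nlinarith
  · subst hij
    by_contra hcon
    push Not at hcon
    have hs0 : 0 < s ^ i := by linarith
    obtain ⟨p', σ, hσ, hxp, hlin⟩ := zone h1 h (t := p / s ^ i) (by rw [hp]; simpa using hε)
    rw [hp] at hxp
    simp only [sub_self, abs_zero, abs_eq_zero, sub_eq_zero] at hxp
    subst hxp
    have d : 0 < q / s ^ i - p / s ^ i := by rw [← sub_div]; exact div_pos (by linarith) hs0
    have d2 : q / s ^ i - p / s ^ i < ε := by
      rw [← sub_div]; exact lt_of_le_of_lt (div_le_self (by linarith) hpi) hcon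
    have := hlin (q / s ^ i) (by rw [abs_of_pos d]; exact d2)
    rw [hq] at this
    rcases hσ with rfl | rfl <;> linarith
  · have := avoid_aux h1 h hij (y := q) (y' := p) (η := 0) (η' := 0) (by simp [hq]) (by simp [hp])
    rw [abs_of_pos (by linarith)] at this
    nlinarith

lemma osc (h1 : 1 < s) {ε : ℝ} (h : NR s ε) (x : ℝ) :
    ∃ t t', x ≤ t ∧ t ≤ t' ∧ t' ≤ x + ε ∧ |rayF s t - rayF s t'| = ε / 2 := by
  have hε := h.1
  have aff : ∀ u v : ℝ, v - u = ε / 2 → (∃ σ q : ℝ, (σ = 1 ∨ σ = -1) ∧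
      ∀ t, u ≤ t → t ≤ v → rayF s t = q + σ * t) → |rayF s u - rayF s v| = ε / 2 := by
    rintro u v huv ⟨σ, q, hσ, hl⟩
    rw [hl u le_rfl (by linarith), hl v (by linarith) le_rfl]
    rcases hσ with rfl | rfl
    · rw [abs_of_neg (by linarith)]; linarith
    · rw [abs_of_pos (by linarith)]; linarith
  rcases affine_or_fold h1 (show x < x + ε / 2 by linarith) with ⟨p, i, hp1, hp2, hi, hp⟩ | ha
  · rcases affine_or_fold h1 (show x + ε / 2 < x + ε by linarith) with ⟨q, j, hq1, hq2, hj, hq⟩ | ha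
    · have := fold_sep h1 h (by linarith) hi hj hp hq
      linarith
    · exact ⟨x + ε / 2, x + ε, by linarith, by linarith, le_rfl, aff _ _ (by ring) ha⟩
  · exact ⟨x, x + ε / 2, le_rfl, by linarith, by linarith, aff _ _ (by ring) ha⟩

/-- half of the ray-map data -/
structure RayH (s : ℝ) (η η' : ℝ → ℝ) : Prop where
  nonneg : ∀ t, 0 ≤ t → 0 ≤ η t
  inv : ∀ t, 0 ≤ t → η' (η t) = t
  cont : ContinuousOn η (Ici 0)
  mono : StrictMonoOn η (Ici 0)
  uc : ∀ (M : ℕ) (δ : ℝ), 0 < δ → ∃ (N : ℕ) (κ : ℝ), 0 < κ ∧ ∀ t t', 0 ≤ t → 0 ≤ t' →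
    |rayF s (t / s ^ N) - rayF s (t' / s ^ N)| ≤ κ →
    |rayF s (η t / s ^ M) - rayF s (η t' / s ^ M)| ≤ δ

lemma coarse (h1 : 1 < s) {ε : ℝ} (h : NR s ε) {η η' : ℝ → ℝ} (H : RayH s η η')
    (H' : RayH s η' η) :
    ∃ C : ℝ, 0 < C ∧ ∀ t t', 0 ≤ t → t ≤ t' → η t' - η t ≤ C * (t' - t + 1) := by
  have hε := h.1
  obtain ⟨N, κ, hκ, huc⟩ := H.uc 0 (ε / 4) (by linarith)
  have hpN : 1 ≤ s ^ N := one_le_pow₀ h1.le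
  have step : ∀ t t', 0 ≤ t → t ≤ t' → t' - t ≤ κ → η t' - η t ≤ ε := by
    intro t t' ht htt hk
    by_contra hcon
    push Not at hcon
    obtain ⟨y, y', hy1, hy2, hy3, hy⟩ := osc h1 h (η t)
    have n0 := H.nonneg t ht
    have pre : ∀ z, η t ≤ z → z ≤ η t' → t ≤ η' z ∧ η' z ≤ t' := by
      intro z hz1 hz2
      have m := H'.mono.monotoneOn
      have a := m (show η t ∈ Ici (0 : ℝ) from n0) (show z ∈ Ici (0 : ℝ) from n0.trans hz1) hz1
      have b := m (show z ∈ Ici (0 : ℝ) from n0.trans hz1)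
        (show η t' ∈ Ici (0 : ℝ) from n0.trans (hz1.trans hz2)) hz2
      rw [H.inv t ht] at a
      rw [H.inv t' (ht.trans htt)] at b
      exact ⟨a, b⟩
    obtain ⟨a1, a2⟩ := pre y hy1 (by linarith)
    obtain ⟨b1, b2⟩ := pre y' (by linarith) (by linarith)
    have := huc (η' y) (η' y') (ht.trans a1) (ht.trans b1) (by
      refine (rayF_lip h1 _ _).trans ?_
      rw [← sub_div, abs_div, abs_of_pos (show 0 < s ^ N by linarith)]
      refine (div_le_self (abs_nonneg _) hpN).trans ?_
      rw [abs_le]; constructor <;> linarith)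
    rw [H'.inv y (by linarith), H'.inv y' (by linarith)] at this
    simp only [pow_zero, div_one] at this
    rw [hy] at this
    linarith
  have many : ∀ n : ℕ, ∀ t t', 0 ≤ t → t ≤ t' → t' - t ≤ n * κ → η t' - η t ≤ n * ε := by
    intro n
    induction n with
    | zero =>
      intro t t' ht htt hk
      have : t = t' := by push_cast at hk; linarith
      subst this; simp
    | succ n ih =>
      intro t t' ht htt hk
      push_cast at hk ⊢
      by_cases hc : t' - t ≤ κ
      · have a := step t t' ht htt hc
        have : 0 ≤ (n : ℝ) * ε := by positivity
        linarith
      · push Not at hc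
        have a := step t (t + κ) ht (by linarith) (by linarith)
        have b := ih (t + κ) t' (by linarith) (by linarith) (by linarith)
        linarith
  refine ⟨ε / κ + ε, by positivity, fun t t' ht htt => ?_⟩
  have hc := Nat.le_ceil ((t' - t) / κ)
  have hc2 := Nat.ceil_lt_add_one (show 0 ≤ (t' - t) / κ from div_nonneg (by linarith) hκ.le)
  have := many ⌈(t' - t) / κ⌉₊ t t' ht htt (by rwa [div_le_iff₀ hκ] at hc)
  have e1 : ((t' - t) / κ + 1) * ε ≤ (ε / κ + ε) * (t' - t + 1) := by
    have : (ε / κ + ε) * (t' - t + 1) - ((t' - t) / κ + 1) * ε = ε / κ + ε * (t' - t) := by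
      field_simp; ring
    have : 0 ≤ ε / κ + ε * (t' - t) := by
      have : 0 ≤ t' - t := by linarith
      positivity
    linarith
  nlinarith

lemma tent_symm (s x : ℝ) : tent s (1 - x) = tent s x := by
  unfold tent; rw [min_comm]; congr 2; ring

/-- Lemma S -/
lemma lemS (h1 : 1 < s) {ε δ : ℝ} (h : NR s ε) (hδ : 0 < δ) (hδε : 20 * δ ≤ ε)
    {η η' : ℝ → ℝ} (H : RayH s η η') (H' : RayH s η' η) (M : ℕ) {R0 : ℝ} (hR0 : 0 < R0) :
    ∃ N : ℕ, ∀ i, N ≤ i → ∀ ρ R : ℝ, R0 ≤ R → R ≤ ρ →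
      (∀ u, 0 ≤ u → u ≤ R → rayF s (ρ + u) + rayF s (ρ - u) = 1) →
      ∃ r, 0 ≤ r ∧ r ≤ s ^ i * R ∧
        η (s ^ i * ρ + s ^ i * R) - η (s ^ i * ρ + r) ≤ 5 * δ * s ^ M ∧
        ∃ l, M < l ∧ |rayF s (η (s ^ i * ρ) / s ^ l) - 1 / 2| * s ^ l ≤ 2 * δ * s ^ M ∧
          (∀ j, M ≤ j → j < l → |rayF s (η (s ^ i * ρ + r) / s ^ j)
            - rayF s (η (s ^ i * ρ - r) / s ^ j)| * s ^ j ≤ δ * s ^ M) ∧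
          |rayF s (η (s ^ i * ρ + r) / s ^ l) + rayF s (η (s ^ i * ρ - r) / s ^ l) - 1| * s ^ l
            ≤ δ * s ^ M := by
  obtain ⟨N0, κ, hκ, huc⟩ := H.uc M δ hδ
  obtain ⟨C, hC, hco⟩ := coarse h1 h H' H
  obtain ⟨N1, hN1⟩ := pow_unbounded_of_one_lt (C * (6 * δ * s ^ M + 1) / R0) h1
  rw [div_lt_iff₀ hR0] at hN1
  refine ⟨max (N0 + 1) N1, fun i hi ρ R hR hRρ hsym => ?_⟩
  have hs : 0 < s := by linarith
  have hpi : 0 < s ^ i := by positivity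
  have hpM : 0 < s ^ M := by positivity
  have hi0 : N0 + 1 ≤ i := (le_max_left _ _).trans hi
  have hi1 : N1 ≤ i := (le_max_right _ _).trans hi
  set t := s ^ i * ρ with ht
  set r0 := s ^ i * R with hr0
  have hr0t : r0 ≤ t := mul_le_mul_of_nonneg_left hRρ hpi.le
  have hr0p : 0 < r0 := mul_pos hpi (by linarith)
  have ht0 : 0 ≤ t := by linarith
  have hclose : ∀ u, 0 ≤ u → u ≤ r0 →
      |rayF s (η (t + u) / s ^ M) - rayF s (η (t - u) / s ^ M)| ≤ δ := by
    intro u hu hur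
    refine huc _ _ (by linarith) (by linarith) ?_
    have e1 : (t + u) / s ^ i = ρ + u / s ^ i := by rw [ht]; field_simp
    have e2 : (t - u) / s ^ i = ρ - u / s ^ i := by rw [ht]; field_simp
    have hsy := hsym (u / s ^ i) (by positivity) (by rw [div_le_iff₀ hpi]; linarith)
    have i1 := rayF_iter h1 (t + u) N0 (i - N0 - 1 + 1)
    have i2 := rayF_iter h1 (t - u) N0 (i - N0 - 1 + 1)
    rw [show N0 + (i - N0 - 1 + 1) = i by omega, e1, iterate_succ_apply] at i1
    rw [show N0 + (i - N0 - 1 + 1) = i by omega, e2, iterate_succ_apply,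
      show rayF s (ρ - u / s ^ i) = 1 - rayF s (ρ + u / s ^ i) by linarith, tent_symm] at i2
    rw [← i1, ← i2, sub_self, abs_zero]
    exact hκ.le
  have hsep : 6 * δ * s ^ M < η (t + r0) - η t := by
    have a := hco (η t) (η (t + r0)) (H.nonneg _ ht0)
      (H.mono.monotoneOn ht0 (show t + r0 ∈ Ici (0 : ℝ) by simp only [mem_Ici]; linarith) (by linarith))
    rw [H.inv _ ht0, H.inv _ (by linarith)] at a
    by_contra hcon
    push Not at hcon
    have b : C * (η (t + r0) - η t + 1) ≤ C * (6 * δ * s ^ M + 1) :=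
      mul_le_mul_of_nonneg_left (by linarith) hC.le
    have c : s ^ N1 * R0 ≤ r0 := by
      rw [hr0]
      exact mul_le_mul (pow_le_pow_right₀ h1.le hi1) hR hR0.le hpi.le
    linarith
  have hcontp : ContinuousOn (fun u => η (t + u)) (Icc 0 r0) := by
    refine H.cont.comp (by fun_prop) ?_
    intro u hu; simp only [mem_Ici]; linarith [hu.1]
  have hcontm : ContinuousOn (fun u => η (t - u)) (Icc 0 r0) := by
    refine H.cont.comp (by fun_prop) ?_
    intro u hu; simp only [mem_Ici]; linarith [hu.2]
  obtain ⟨r, hr1, hr2, hr3, hgood⟩ : ∃ r, 0 ≤ r ∧ r ≤ r0 ∧ η (t + r0) - η (t + r) ≤ 5 * δ * s ^ M ∧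
      Good s δ (η (t + r) / s ^ M) := by
    rcases avoid h1 h hδ hδε (η (t + r0) / s ^ M) with hg | hg
    · refine ⟨r0, hr0p.le, le_rfl, ?_, hg⟩
      rw [sub_self]; positivity
    · have hv : η (t + r0) - 5 * δ * s ^ M ∈ Icc (η (t + 0)) (η (t + r0)) := by
        have : 0 < δ * s ^ M := by positivity
        rw [add_zero]; constructor <;> linarith
      obtain ⟨r, hr, hre⟩ := intermediate_value_Icc hr0p.le hcontp hv
      simp only at hre
      refine ⟨r, hr.1, hr.2, by linarith, ?_⟩
      rw [hre]
      convert hg using 1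
      field_simp
  have hsub : Icc 0 r ⊆ Icc 0 r0 := Icc_subset_Icc_right hr2
  have hδM : 0 < δ * s ^ M := by positivity
  obtain ⟨l, hl, c2, c3, c1⟩ := core h1 h hδ hδε (a := fun u => η (t + u) / s ^ M)
    (b := fun u => η (t - u) / s ^ M) hr1 ((hcontp.mono hsub).div_const _)
    ((hcontm.mono hsub).div_const _)
    (by
      intro x hx y hy hxy
      refine div_lt_div_of_pos_right (H.mono ?_ ?_ (by linarith)) hpM
      · simp only [mem_Ici]; linarith [hx.1]
      · simp only [mem_Ici]; linarith [hy.1])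
    (by
      intro x hx y hy hxy
      refine div_lt_div_of_pos_right (H.mono ?_ ?_ (by linarith)) hpM
      · simp only [mem_Ici]; linarith [hy.2]
      · simp only [mem_Ici]; linarith [hx.2])
    (by simp) (fun u hu => hclose u hu.1 (hu.2.trans hr2))
    (by
      have : η (t - r) ≤ η t := H.mono.monotoneOn
        (show t - r ∈ Ici (0 : ℝ) by simp only [mem_Ici]; linarith) ht0 (by linarith)
      rw [← sub_div, lt_div_iff₀ hpM]
      linarith) hgood
  have dd : ∀ (x : ℝ) (j : ℕ), x / s ^ M / s ^ j = x / s ^ (M + j) := by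
    intro x j; rw [div_div, pow_add]
  have conv : ∀ (A D : ℝ) (j : ℕ), A ≤ D / s ^ j → A * s ^ (M + j) ≤ D * s ^ M := by
    intro A D j hA
    rw [le_div_iff₀ (by positivity)] at hA
    rw [pow_add]
    calc A * (s ^ M * s ^ j) = (A * s ^ j) * s ^ M := by ring
      _ ≤ _ := mul_le_mul_of_nonneg_right hA hpM.le
  refine ⟨r, hr1, hr2, hr3, M + l, by omega, ?_, ?_, ?_⟩
  · refine conv _ _ _ ?_
    simpa only [dd, add_zero] using c1
  · intro j hj1 hj2
    obtain ⟨j', rfl⟩ := Nat.exists_eq_add_of_le hj1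
    refine conv _ _ _ ?_
    simpa only [dd] using c2 j' (by omega)
  · refine conv _ _ _ ?_
    simpa only [dd] using c3

lemma x0_far (h1 : 1 < s) {ε : ℝ} (h : NR s ε) (h2 : s < 2) (n i : ℕ) :
    ε ≤ |rayF s ((1 - s / 2) * s ^ n / s ^ i) - 1 / 2| := by
  have hle := h.le h1
  have hs : 0 < s := by linarith
  rcases lt_or_ge i n with hin | hin
  · have e := rayF_iter h1 ((1 - s / 2) * s ^ n) i (n - i - 1 + 1)
    rw [show i + (n - i - 1 + 1) = n by omega, mul_div_cancel_right₀ _ (by positivity),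
      rayF_id h1 (by linarith), iterate_succ_apply, tent_symm] at e
    have := h.2 (n - i - 1 + 1 + 1) (by omega)
    rw [iterate_succ_apply, iterate_succ_apply, tent_le_half h1 le_rfl,
      show s * (1 / 2) = s / 2 by ring, e] at this
    exact this
  · have hpn : 0 < s ^ n := by positivity
    have hpi : 0 < s ^ i := by positivity
    have hni : s ^ n ≤ s ^ i := pow_le_pow_right₀ h1.le hin
    have : (1 - s / 2) * s ^ n / s ^ i ≤ 1 - s / 2 := by
      rw [div_le_iff₀ hpi]; exact mul_le_mul_of_nonneg_left hni (by linarith)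
    rw [rayF_id h1 (by linarith), abs_of_neg (by linarith)]
    linarith

set_option maxHeartbeats 4000000 in
lemma main_asymp (h1 : 1 < s) (h2 : s < 2) {ε : ℝ} (h : NR s ε) {η η' : ℝ → ℝ}
    (H : RayH s η η') (H' : RayH s η' η) :
    ∃ b : ℤ, ∀ δ' : ℝ, 0 < δ' → ∃ N : ℕ, ∀ n, N ≤ n → ∃ l : ℕ, (l : ℤ) = n + b ∧
      |rayF s (η (s ^ n * (1 / 2)) / s ^ l) - 1 / 2| * s ^ l ≤ δ' := by
  have hε := h.1
  have hle := h.le h1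
  have hs : 0 < s := by linarith
  obtain ⟨C1, hC1, hco1⟩ := coarse h1 h H' H
  obtain ⟨C2, hC2, hco2⟩ := coarse h1 h H H'
  obtain ⟨I, hI⟩ := pow_unbounded_of_one_lt (8 * C1 / ε) h1
  rw [div_lt_iff₀ hε] at hI
  obtain ⟨M, hM⟩ := lemS h1 h (δ := ε / 40) (by positivity) (by linarith) H' H I
    (R0 := ε / 2) (by positivity)
  have hpM : 0 < s ^ M := by positivity
  set δ := min (ε / 20) (1 / (20 * s ^ M)) with hδdef
  have hδ : 0 < δ := lt_min (by positivity) (by positivity)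
  have hδε : 20 * δ ≤ ε := by have := min_le_left (ε / 20) (1 / (20 * s ^ M)); linarith
  have hδM : 20 * δ * s ^ M ≤ 1 := by
    have := min_le_right (ε / 20) (1 / (20 * s ^ M))
    rw [← hδdef, le_div_iff₀ (by positivity)] at this
    linarith
  have hδM0 : 0 < δ * s ^ M := by positivity
  have hsym : ∀ u, 0 ≤ u → u ≤ (s - 1) / 2 → rayF s (1 / 2 + u) + rayF s (1 / 2 - u) = 1 := by
    intro u hu hu2
    rw [rayF_id h1 (by linarith), rayF_id h1 (by linarith)]; ring
  obtain ⟨N1, hN1⟩ := lemS h1 h hδ hδε H H' M (R0 := (s - 1) / 2) (by linarith)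
  have hS := fun n (hn : N1 ≤ n) => hN1 n hn (1 / 2) ((s - 1) / 2) le_rfl (by linarith) hsym
  have hS' : ∀ n, ∃ r l, N1 ≤ n → 0 ≤ r ∧ r ≤ s ^ n * ((s - 1) / 2) ∧
        η (s ^ n * (1 / 2) + s ^ n * ((s - 1) / 2)) - η (s ^ n * (1 / 2) + r) ≤ 5 * δ * s ^ M ∧
        M < l ∧ |rayF s (η (s ^ n * (1 / 2)) / s ^ l) - 1 / 2| * s ^ l ≤ 2 * δ * s ^ M ∧
          (∀ j, M ≤ j → j < l → |rayF s (η (s ^ n * (1 / 2) + r) / s ^ j)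
            - rayF s (η (s ^ n * (1 / 2) - r) / s ^ j)| * s ^ j ≤ δ * s ^ M) ∧
          |rayF s (η (s ^ n * (1 / 2) + r) / s ^ l) + rayF s (η (s ^ n * (1 / 2) - r) / s ^ l) - 1|
            * s ^ l ≤ δ * s ^ M := by
    intro n
    by_cases hn : N1 ≤ n
    · obtain ⟨r, a1, a2, a3, l, a4, a5, a6, a7⟩ := hS n hn
      exact ⟨r, l, fun _ => ⟨a1, a2, a3, a4, a5, a6, a7⟩⟩
    · exact ⟨0, 0, fun h => absurd h hn⟩
  clear hS
  choose r l hrl using hS'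
  have hstep : ∀ n, N1 ≤ n → l n < l (n + 1) := by
    intro n hn
    obtain ⟨a1, a2, a3, a4, a5, a6, a7⟩ := hrl n hn
    obtain ⟨b1, b2, b3, b4, b5, b6, b7⟩ := hrl (n + 1) (by omega)
    by_contra hcon
    push Not at hcon
    clear b1 b2 b3 b6 b7
    set l' := l (n + 1) with hl'
    set t := s ^ n * (1 / 2) with ht
    have hpn : 0 < s ^ n := by positivity
    have hpl : 0 < s ^ l' := by positivity
    have htr : s ^ n * ((s - 1) / 2) ≤ t := by rw [ht]; nlinarith
    have ht1 : s ^ (n + 1) * (1 / 2) = t + s ^ n * ((s - 1) / 2) := by rw [ht, pow_succ]; ring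
    rw [ht1] at b5
    set r0 := s ^ n * ((s - 1) / 2) with hr0
    have ht0 : 0 < t := by positivity
    have hmono : η (t + r n) ≤ η (t + r0) := H.mono.monotoneOn
      (show t + r n ∈ Ici (0 : ℝ) by simp only [mem_Ici]; linarith)
      (show t + r0 ∈ Ici (0 : ℝ) by simp only [mem_Ici]; linarith) (by linarith)
    have c1 : |rayF s (η (t + r n) / s ^ l') - 1 / 2| * s ^ l' ≤ 7 * δ * s ^ M := by
      have d1 := rayF_lip h1 (η (t + r n) / s ^ l') (η (t + r0) / s ^ l')
      rw [← sub_div, abs_div, abs_of_pos hpl, le_div_iff₀ hpl] at d1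
      rw [abs_of_nonpos (by linarith : η (t + r n) - η (t + r0) ≤ 0)] at d1
      have d2 := abs_sub_le (rayF s (η (t + r n) / s ^ l')) (rayF s (η (t + r0) / s ^ l')) (1 / 2)
      nlinarith
    have c2 : |rayF s (η (t - r n) / s ^ l') - 1 / 2| * s ^ l' ≤ 8 * δ * s ^ M := by
      rcases lt_or_eq_of_le hcon with hlt | heq
      · have d := a6 l' b4.le hlt
        have d2 := abs_sub_le (rayF s (η (t - r n) / s ^ l')) (rayF s (η (t + r n) / s ^ l')) (1 / 2)
        rw [abs_sub_comm (rayF s (η (t - r n) / s ^ l')) (rayF s (η (t + r n) / s ^ l'))] at d2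
        nlinarith
      · rw [← heq] at a7
        have d2 := abs_sub_le (rayF s (η (t - r n) / s ^ l'))
          (1 - rayF s (η (t + r n) / s ^ l')) (1 / 2)
        rw [show rayF s (η (t - r n) / s ^ l') - (1 - rayF s (η (t + r n) / s ^ l'))
          = rayF s (η (t + r n) / s ^ l') + rayF s (η (t - r n) / s ^ l') - 1 by ring,
          show 1 - rayF s (η (t + r n) / s ^ l') - 1 / 2
            = -(rayF s (η (t + r n) / s ^ l') - 1 / 2) by ring, abs_neg] at d2
        nlinarith
    have hMl : s ^ M ≤ s ^ l' := pow_le_pow_right₀ h1.le b4.le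
    have c3 : |rayF s (η (t - r n) / s ^ l') - 1 / 2| < ε := by
      by_contra hc
      push Not at hc
      have : ε * s ^ M ≤ |rayF s (η (t - r n) / s ^ l') - 1 / 2| * s ^ l' :=
        mul_le_mul hc hMl hpM.le (abs_nonneg _)
      nlinarith
    obtain ⟨p, σ, hσ, hxp, hlin⟩ := zone h1 h c3
    have hp12 : rayF s p = 1 / 2 := by
      rw [hlin p (by simpa using hε)]; ring
    have hpge : 1 / 2 ≤ p := by
      by_contra hc
      push Not at hc
      rw [rayF_id h1 (by linarith)] at hp12
      linarith
    obtain ⟨_, _, _, _, l2, e1, e2, _⟩ := hM l' b4.le p (ε / 2) le_rfl (by linarith) (by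
      intro u hu hu2
      rw [hlin (p + u) (by rw [add_sub_cancel_left, abs_of_nonneg hu]; linarith),
        hlin (p - u) (by rw [sub_sub_cancel_left, abs_neg, abs_of_nonneg hu]; linarith)]
      ring)
    have hz0 : 0 ≤ t - r n := by linarith
    have hq : |s ^ l' * p - η (t - r n)| ≤ 1 := by
      have : s ^ l' * p - η (t - r n) = -((η (t - r n) / s ^ l' - p) * s ^ l') := by
        field_simp; ring
      rw [this, abs_neg, abs_mul, hxp, abs_of_pos hpl]
      linarith
    have hcl : ∀ y y', 0 ≤ y → 0 ≤ y' → |y - y'| ≤ 1 → |η' y - η' y'| ≤ 2 * C1 := by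
      intro y y' hy hy' hyy
      have hb := abs_le.1 hyy
      rcases le_total y y' with hc | hc
      · have m := H'.mono.monotoneOn (show y ∈ Ici (0 : ℝ) from hy) (show y' ∈ Ici (0 : ℝ) from hy') hc
        have := hco1 y y' hy hc
        have q := mul_le_mul_of_nonneg_left (show y' - y + 1 ≤ 2 by linarith) hC1.le
        rw [abs_of_nonpos (by linarith)]
        linarith
      · have m := H'.mono.monotoneOn (show y' ∈ Ici (0 : ℝ) from hy') (show y ∈ Ici (0 : ℝ) from hy) hc
        have := hco1 y' y hy' hc
        have q := mul_le_mul_of_nonneg_left (show y - y' + 1 ≤ 2 by linarith) hC1.le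
        rw [abs_of_nonneg (by linarith)]
        linarith
    have f1 := hcl (s ^ l' * p) (η (t - r n)) (by positivity) (H.nonneg _ hz0) hq
    rw [H.inv _ hz0] at f1
    have f2 := hcl (η (t + r0)) (η (t + r n)) (H.nonneg _ (by linarith)) (H.nonneg _ (by linarith))
      (by rw [abs_of_nonneg (by linarith)]; linarith)
    rw [H.inv _ (by linarith), H.inv _ (by linarith)] at f2
    have hx0 : t - r0 = (1 - s / 2) * s ^ n := by rw [ht, hr0]; ring
    have f3 : |(1 - s / 2) * s ^ n - η' (s ^ l' * p)| ≤ 4 * C1 := by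
      rw [← hx0]
      have g1 := abs_le.1 f1
      have g2 := abs_le.1 f2
      rw [abs_le]; constructor <;> linarith
    have far := x0_far h1 h h2 n l2
    have hpl2 : 0 < s ^ l2 := by positivity
    have f4 := rayF_lip h1 ((1 - s / 2) * s ^ n / s ^ l2) (η' (s ^ l' * p) / s ^ l2)
    rw [← sub_div, abs_div, abs_of_pos hpl2, le_div_iff₀ hpl2] at f4
    have f5 := abs_sub_le (rayF s ((1 - s / 2) * s ^ n / s ^ l2))
      (rayF s (η' (s ^ l' * p) / s ^ l2)) (1 / 2)
    have hIl : s ^ I ≤ s ^ l2 := pow_le_pow_right₀ h1.le e1.le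
    have f6 : ε * s ^ l2 ≤ 4 * C1 + 2 * (ε / 40) * s ^ I := by nlinarith
    nlinarith
  -- upper bound
  obtain ⟨k, hk⟩ := pow_unbounded_of_one_lt (4 * (η 0 + 2 * C2)) h1
  have hup : ∀ n, N1 ≤ n → l n ≤ n + k := by
    intro n hn
    obtain ⟨a1, a2, a3, a4, a5, a6, a7⟩ := hrl n hn
    have hpl : 0 < s ^ l n := by positivity
    have hpn : 1 ≤ s ^ n := one_le_pow₀ h1.le
    have hMl : s ^ M ≤ s ^ l n := pow_le_pow_right₀ h1.le a4.le
    have a8 : |rayF s (η (s ^ n * (1 / 2)) / s ^ l n) - 1 / 2| ≤ 2 * δ := by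
      by_contra hc
      push Not at hc
      nlinarith
    have hε4 : ε ≤ 1 / 2 := by linarith
    have a9 := (abs_le.1 a8).1
    have a10 : 1 / 4 ≤ η (s ^ n * (1 / 2)) / s ^ l n := by
      by_contra hc
      push Not at hc
      rw [rayF_id h1 (by linarith)] at a9
      linarith
    rw [le_div_iff₀ hpl] at a10
    have a11 := hco2 0 (s ^ n * (1 / 2)) le_rfl (by positivity)
    have n0 := H.nonneg 0 le_rfl
    have a12 : s ^ l n ≤ s ^ (n + k) := by
      rw [pow_add]; nlinarith
    exact (pow_le_pow_iff_right₀ h1).1 a12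
  -- eventually constant
  obtain ⟨b, ⟨n1, hn1, hbn⟩, hmax⟩ := Int.exists_greatest_of_bdd
    (P := fun b => ∃ n, N1 ≤ n ∧ (l n : ℤ) - n = b)
    ⟨k, by
      rintro z ⟨n, hn, rfl⟩
      have := hup n hn
      omega⟩ ⟨_, N1, le_rfl, rfl⟩
  have hconst : ∀ n, n1 ≤ n → (l n : ℤ) = n + b := by
    intro n hn
    induction n, hn using Nat.le_induction with
    | base => omega
    | succ n hn ih =>
      have a := hstep n (by omega)
      have c := hmax _ ⟨n + 1, by omega, rfl⟩
      push_cast at c ⊢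
      omega
  refine ⟨b, fun δ' hδ' => ?_⟩
  set δ1 := min δ (δ' / (2 * s ^ M)) with hδ1
  have hδ1p : 0 < δ1 := lt_min hδ (by positivity)
  have hδ1δ : δ1 ≤ δ := min_le_left _ _
  have hδ1' : 2 * δ1 * s ^ M ≤ δ' := by
    have := min_le_right δ (δ' / (2 * s ^ M))
    rw [← hδ1, le_div_iff₀ (by positivity)] at this
    linarith
  obtain ⟨N2, hN2⟩ := lemS h1 h hδ1p (by linarith) H H' M (R0 := (s - 1) / 2) (by linarith)
  refine ⟨max N2 (max N1 n1), fun n hn => ?_⟩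
  obtain ⟨_, _, _, _, l1, e1, e2, _⟩ := hN2 n (by omega) (1 / 2) ((s - 1) / 2) le_rfl
    (by linarith) hsym
  obtain ⟨a1, a2, a3, a4, a5, a6, a7⟩ := hrl n (by omega)
  have hδδ : δ1 * s ^ M ≤ δ * s ^ M := mul_le_mul_of_nonneg_right hδ1δ hpM.le
  have : l1 = l n := by
    rcases lt_trichotomy l1 (l n) with hc | hc | hc
    · exfalso
      have := avoid_aux h1 h hc e2 a5
      rw [sub_self, abs_zero] at this
      have hMl : s ^ M ≤ s ^ l1 := pow_le_pow_right₀ h1.le e1.le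
      nlinarith
    · exact hc
    · exfalso
      have := avoid_aux h1 h hc a5 e2
      rw [sub_self, abs_zero] at this
      have hMl : s ^ M ≤ s ^ l n := pow_le_pow_right₀ h1.le a4.le
      nlinarith
  exact ⟨l1, by rw [this]; exact hconst n (by omega), e2.trans hδ1'⟩

lemma tent_mem (h1 : 1 < s) (h2 : s < 2) {x : ℝ} (hx : x ∈ Icc (0 : ℝ) 1) :
    tent s x ∈ Icc (0 : ℝ) 1 := by
  refine ⟨?_, (tent_le h1 x).trans (by linarith)⟩
  exact le_min (mul_nonneg (by linarith) hx.1) (mul_nonneg (by linarith) (by linarith [hx.2]))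

lemma tent_iter_mem (h1 : 1 < s) (h2 : s < 2) (k : ℕ) {x : ℝ} (hx : x ∈ Icc (0 : ℝ) 1) :
    (tent s)^[k] x ∈ Icc (0 : ℝ) 1 := by
  induction k with
  | zero => exact hx
  | succ k ih => rw [iterate_succ_apply']; exact tent_mem h1 h2 ih

lemma rayF_mem (h1 : 1 < s) (h2 : s < 2) {t : ℝ} (ht : 0 ≤ t) : rayF s t ∈ Icc (0 : ℝ) 1 := by
  obtain ⟨k, hk⟩ := exists_pow_half h1 t
  have hp : 0 < s ^ k := by positivity
  rw [rayF_eq h1 hk]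
  refine tent_iter_mem h1 h2 k ⟨by positivity, ?_⟩
  rw [div_le_one hp]; linarith

/-- parametrisation of the ray -/
def phi (h1 : 1 < s) (h2 : s < 2) (t : ℝ) : invLim s :=
  ⟨fun n => rayF s (max t 0 / s ^ n),
    fun _ => rayF_mem h1 h2 (div_nonneg (le_max_right _ _) (by positivity)),
    fun n => (rayF_succ h1 _ n).symm⟩

lemma phi_coord (h1 : 1 < s) (h2 : s < 2) {t : ℝ} (ht : 0 ≤ t) (n : ℕ) :
    (phi h1 h2 t).1 n = rayF s (t / s ^ n) := by
  simp only [phi, max_eq_left ht]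

lemma phi_continuous (h1 : 1 < s) (h2 : s < 2) : Continuous (phi h1 h2) := by
  refine Continuous.subtype_mk (continuous_pi fun n => ?_) _
  exact (rayF_continuous h1).comp ((continuous_id.max continuous_const).div_const _)

lemma coord_iter (x : invLim s) (n k : ℕ) : (tent s)^[k] (x.1 (n + k)) = x.1 n := by
  induction k with
  | zero => rfl
  | succ k ih => rw [iterate_succ_apply, ← add_assoc, ← x.2.2 (n + k)]; exact ih

lemma agree_le {x y : invLim s} {n m : ℕ} (hnm : n ≤ m) (h : x.1 m = y.1 m) : x.1 n = y.1 n := by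
  obtain ⟨k, rfl⟩ := Nat.exists_eq_add_of_le hnm
  rw [← coord_iter x n k, ← coord_iter y n k, h]

lemma ext_tail {x y : invLim s} (N : ℕ) (h : ∀ n, N ≤ n → x.1 n = y.1 n) : x = y := by
  apply Subtype.ext
  funext n
  exact agree_le (le_max_right N n) (h _ (le_max_left N n))

lemma coord_le (h1 : 1 < s) (x : invLim s) (n : ℕ) : x.1 n ≤ s / 2 := by
  rw [x.2.2 n]; exact tent_le h1 _

lemma coord_lip (h1 : 1 < s) (x y : invLim s) {n m : ℕ} (hnm : n ≤ m) :
    |x.1 n - y.1 n| ≤ s ^ (m - n) * |x.1 m - y.1 m| := by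
  obtain ⟨k, rfl⟩ := Nat.exists_eq_add_of_le hnm
  rw [← coord_iter x n k, ← coord_iter y n k, Nat.add_sub_cancel_left]
  exact tent_iter_lip h1 k _ _

/-- lower end of the core -/
def c2 (s : ℝ) : ℝ := s * (1 - s / 2)

lemma c2_pos (h1 : 1 < s) (h2 : s < 2) : 0 < c2 s := mul_pos (by linarith) (by linarith)

lemma c2_le (h1 : 1 < s) : c2 s ≤ s / 2 := by unfold c2; nlinarith

/-- points off the core -/
def Low (x : invLim s) : Prop := ∃ n, x.1 n < c2 s

lemma low_eq (h1 : 1 < s) (h2 : s < 2) {x : invLim s} {N : ℕ} (hx : x.1 N < c2 s) :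
    x = phi h1 h2 (s ^ N * x.1 N) := by
  have hs : 0 < s := by linarith
  have hx0 : 0 ≤ x.1 N := (x.2.1 N).1
  have key : ∀ k, x.1 (N + k) = x.1 N / s ^ k := by
    intro k
    induction k with
    | zero => simp
    | succ k ih =>
      have hk : 1 ≤ s ^ k := one_le_pow₀ h1.le
      have e := x.2.2 (N + k)
      have hlt : x.1 (N + k) < c2 s := by
        rw [ih]; exact lt_of_le_of_lt (div_le_self hx0 hk) hx
      have hle := coord_le h1 x (N + k + 1)
      have : x.1 (N + k + 1) ≤ 1 / 2 := by
        by_contra hc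
        push Not at hc
        rw [tent_ge_half h1 hc.le] at e
        rw [e] at hlt
        unfold c2 at hlt
        nlinarith
      rw [tent_le_half h1 this, ih] at e
      rw [← add_assoc, pow_succ]
      field_simp
      field_simp at e
      linarith
  apply ext_tail N
  intro n hn
  obtain ⟨k, rfl⟩ := Nat.exists_eq_add_of_le hn
  have hk : 1 ≤ s ^ k := one_le_pow₀ h1.le
  have e : s ^ N * x.1 N / s ^ (N + k) = x.1 N / s ^ k := by rw [pow_add]; field_simp
  rw [phi_coord h1 h2 (by positivity), e, rayF_id h1, key]
  have := div_le_self hx0 hk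
  have := c2_le h1
  linarith

lemma phi_low (h1 : 1 < s) (h2 : s < 2) {t : ℝ} (ht : 0 ≤ t) :
    ∃ N, ∀ n, N ≤ n → (phi h1 h2 t).1 n = t / s ^ n ∧ t / s ^ n < c2 s := by
  have hc := c2_pos h1 h2
  obtain ⟨N, hN⟩ := pow_unbounded_of_one_lt (t / c2 s) h1
  rw [div_lt_iff₀ hc] at hN
  refine ⟨N, fun n hn => ?_⟩
  have hp : 0 < s ^ n := by positivity
  have hle : s ^ N ≤ s ^ n := pow_le_pow_right₀ h1.le hn
  have : t / s ^ n < c2 s := by rw [div_lt_iff₀ hp]; nlinarith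
  refine ⟨?_, this⟩
  rw [phi_coord h1 h2 ht, rayF_id h1]
  have := c2_le h1
  linarith

lemma phi_inj (h1 : 1 < s) (h2 : s < 2) {t t' : ℝ} (ht : 0 ≤ t) (ht' : 0 ≤ t')
    (h : phi h1 h2 t = phi h1 h2 t') : t = t' := by
  obtain ⟨N, hN⟩ := phi_low h1 h2 ht
  obtain ⟨N', hN'⟩ := phi_low h1 h2 ht'
  have a := (hN (max N N') (le_max_left _ _)).1
  have b := (hN' (max N N') (le_max_right _ _)).1
  rw [h, b] at a
  have hp : s ^ (max N N') ≠ 0 := by positivity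
  field_simp at a
  exact a.symm

lemma low_phi (h1 : 1 < s) (h2 : s < 2) {t : ℝ} (ht : 0 ≤ t) : Low (phi h1 h2 t) := by
  obtain ⟨N, hN⟩ := phi_low h1 h2 ht
  exact ⟨N, by rw [(hN N le_rfl).1]; exact (hN N le_rfl).2⟩

lemma low_exists (h1 : 1 < s) (h2 : s < 2) {x : invLim s} (hx : Low x) :
    ∃ t, 0 ≤ t ∧ x = phi h1 h2 t := by
  obtain ⟨N, hN⟩ := hx
  exact ⟨_, mul_nonneg (by positivity) (x.2.1 N).1, low_eq h1 h2 hN⟩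

lemma invLim_closed (s : ℝ) : IsClosed (invLim s) := by
  have : invLim s = (⋂ n, {x : ℕ → ℝ | x n ∈ Icc (0 : ℝ) 1}) ∩
      ⋂ n, {x : ℕ → ℝ | x n = tent s (x (n + 1))} := by
    ext x; simp [invLim]
  rw [this]
  refine (isClosed_iInter fun n => isClosed_Icc.preimage (continuous_apply n)).inter
    (isClosed_iInter fun n => ?_)
  exact isClosed_eq (continuous_apply n) ((tent_continuous s).comp (continuous_apply (n + 1)))

instance compK (s : ℝ) : CompactSpace (invLim s) := by
  rw [← isCompact_iff_compactSpace]
  refine (isCompact_univ_pi (s := fun _ : ℕ => Icc (0 : ℝ) 1) fun _ => isCompact_Icc).of_isClosed_subset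
    (invLim_closed s) ?_
  intro x hx n _
  exact hx.1 n

lemma coord_continuous (n : ℕ) : Continuous (fun x : invLim s => x.1 n) :=
  (continuous_apply n).comp continuous_subtype_val

lemma tendsto_iff_coord {ι : Type*} {l : Filter ι} {u : ι → invLim s} {x : invLim s} :
    Tendsto u l (𝓝 x) ↔ ∀ n, Tendsto (fun i => (u i).1 n) l (𝓝 (x.1 n)) := by
  rw [tendsto_subtype_rng, tendsto_pi_nhds]

lemma mem_of_agree {A : Set (invLim s)} (hA : IsClosed A) {z : invLim s} (N0 : ℕ)
    (h : ∀ N, N0 ≤ N → ∃ a ∈ A, a.1 N = z.1 N) : z ∈ A := by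
  haveI : Nonempty (invLim s) := ⟨z⟩
  choose! a ha using h
  refine hA.mem_of_tendsto (b := atTop) (f := a) (x := z) ?_ ?_
  · rw [tendsto_iff_coord]
    intro n
    refine tendsto_const_nhds.congr' ?_
    filter_upwards [eventually_ge_atTop N0, eventually_ge_atTop n] with N h1 h2
    exact (agree_le h2 (ha N h1).2).symm
  · filter_upwards [eventually_ge_atTop N0] with N h1
    exact (ha N h1).1

/-- irreducibility between two points -/
def Irr (x y : invLim s) : Prop :=
  ∀ A : Set (invLim s), IsCompact A → IsConnected A → x ∈ A → y ∈ A → A = univ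

lemma irr_of_not_low (h1 : 1 < s) (h2 : s < 2) {y : invLim s} (hy : ¬ Low y) :
    Irr (phi h1 h2 0) y := by
  intro A hAc hAconn h0 hyA
  unfold Low at hy
  push Not at hy
  have hs : 0 < s := by linarith
  rw [eq_univ_iff_forall]
  intro z
  refine mem_of_agree hAc.isClosed 0 fun N _ => ?_
  have hz0 : 0 ≤ z.1 N := (z.2.1 N).1
  have hc := c2_pos h1 h2
  have hzle := coord_le h1 z N
  obtain ⟨k1, hk1⟩ := exists_pow_half h1 (z.1 N)
  obtain ⟨k2, hk2⟩ := pow_unbounded_of_one_lt (z.1 N / c2 s) h1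
  rw [div_lt_iff₀ hc] at hk2
  set k := max k1 k2
  have e1 : s ^ k1 ≤ s ^ k := pow_le_pow_right₀ h1.le (le_max_left _ _)
  have e2 : s ^ k2 ≤ s ^ k := pow_le_pow_right₀ h1.le (le_max_right _ _)
  have hpk : 0 < s ^ k := by positivity
  have hconn : IsPreconnected ((fun x : invLim s => x.1 (N + k)) '' A) :=
    hAconn.isPreconnected.image _ (coord_continuous _).continuousOn
  have hsub := hconn.Icc_subset (mem_image_of_mem _ h0) (mem_image_of_mem _ hyA)
  have hmem : z.1 N / s ^ k ∈ Icc ((phi h1 h2 0).1 (N + k)) (y.1 (N + k)) := by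
    rw [phi_coord h1 h2 le_rfl, zero_div, rayF_id h1 (by linarith)]
    refine ⟨by positivity, le_trans ?_ (hy _)⟩
    rw [div_le_iff₀ hpk]; nlinarith
  obtain ⟨a, haA, hak⟩ := hsub hmem
  refine ⟨a, haA, ?_⟩
  simp only at hak
  rw [← coord_iter a N k, hak, ← rayF_eq h1 (by linarith), rayF_id h1 hzle]

lemma prop_cont (h1 : 1 < s) (h2 : s < 2) {x y : invLim s} (hx : x ≠ phi h1 h2 0)
    (hy : y ≠ phi h1 h2 0) : ∃ A : Set (invLim s), IsCompact A ∧ IsConnected A ∧ A ≠ univ ∧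
      x ∈ A ∧ y ∈ A := by
  have hs : 0 < s := by linarith
  have hc := c2_pos h1 h2
  have key : ∀ z : invLim s, z ≠ phi h1 h2 0 → ∃ a > 0, z ∈ closure (phi h1 h2 '' Ici a) := by
    intro z hz
    by_cases hl : Low z
    · obtain ⟨t, ht, rfl⟩ := low_exists h1 h2 hl
      refine ⟨t, lt_of_le_of_ne ht ?_, subset_closure (mem_image_of_mem _ self_mem_Ici)⟩
      rintro rfl; exact hz rfl
    · refine ⟨1, one_pos, ?_⟩
      unfold Low at hl
      push Not at hl
      obtain ⟨N0, hN0⟩ := pow_unbounded_of_one_lt (1 / c2 s) h1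
      rw [div_lt_iff₀ hc] at hN0
      refine mem_of_agree isClosed_closure N0 fun N hN => ?_
      have hle : s ^ N0 ≤ s ^ N := pow_le_pow_right₀ h1.le hN
      have hpN : 0 < s ^ N := by positivity
      have hzN := hl N
      have hge : 1 ≤ s ^ N * z.1 N := by nlinarith
      refine ⟨phi h1 h2 (s ^ N * z.1 N), subset_closure (mem_image_of_mem _ hge), ?_⟩
      rw [phi_coord h1 h2 (by linarith), mul_div_cancel_left₀ _ hpN.ne', rayF_id h1 (coord_le h1 z N)]
  obtain ⟨a, ha, hxa⟩ := key x hx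
  obtain ⟨b, hb, hyb⟩ := key y hy
  have hmab : 0 < min a b := lt_min ha hb
  refine ⟨closure (phi h1 h2 '' Ici (min a b)), isClosed_closure.isCompact, ?_, ?_,
    closure_mono (image_mono (Ici_subset_Ici.2 (min_le_left _ _))) hxa,
    closure_mono (image_mono (Ici_subset_Ici.2 (min_le_right _ _))) hyb⟩
  · refine (IsConnected.image ⟨nonempty_Ici, ordConnected_Ici.isPreconnected⟩ _
      (phi_continuous h1 h2).continuousOn).closure
  · intro hu
    have hsub : closure (phi h1 h2 '' Ici (min a b)) ⊆
        {x : invLim s | min (min a b) (c2 s) ≤ x.1 0} := by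
      refine closure_minimal ?_ (isClosed_le continuous_const (coord_continuous 0))
      rintro _ ⟨t, ht, rfl⟩
      have ht0 : 0 ≤ t := hmab.le.trans ht
      show _ ≤ (phi h1 h2 t).1 0
      by_cases hlt : (phi h1 h2 t).1 0 < c2 s
      · have e := low_eq h1 h2 hlt
        rw [pow_zero, one_mul] at e
        have := phi_inj h1 h2 ht0 ((phi h1 h2 t).2.1 0).1 e
        rw [← this]
        exact (min_le_left _ _).trans ht
      · exact (min_le_right _ _).trans (not_lt.1 hlt)
    rw [hu] at hsub
    have h0 : min (min a b) (c2 s) ≤ (phi h1 h2 0).1 0 := hsub (mem_univ _)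
    rw [phi_coord h1 h2 le_rfl, zero_div, rayF_id h1 (by linarith)] at h0
    have : 0 < min (min a b) (c2 s) := lt_min hmab hc
    linarith

lemma not_irr (h1 : 1 < s) (h2 : s < 2) {x y : invLim s} (hx : x ≠ phi h1 h2 0)
    (hy : y ≠ phi h1 h2 0) : ¬ Irr x y := by
  obtain ⟨A, a1, a2, a3, a4, a5⟩ := prop_cont h1 h2 hx hy
  exact fun h => a3 (h A a1 a2 a4 a5)

/-- two points of the core -/
lemma two_core (h1 : 1 < s) (h2 : s < 2) : ∃ x y : invLim s, x ≠ y ∧ ¬ Low x ∧ ¬ Low y := by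
  have hs : 0 < s := by linarith
  have hd : 0 < 1 + s ^ 2 := by positivity
  set p := s / (1 + s ^ 2) with hp
  set q := s ^ 2 / (1 + s ^ 2) with hq
  have hp0 : 0 < p := by positivity
  have hq0 : 0 < q := by positivity
  have hp1 : p ≤ 1 / 2 := by rw [hp, div_le_iff₀ hd]; nlinarith [sq_nonneg (s - 1)]
  have hq1 : 1 / 2 ≤ q := by rw [hq, le_div_iff₀ hd]; nlinarith
  have hq2 : q ≤ 1 := by rw [hq, div_le_one hd]; linarith
  have hpc : c2 s ≤ p := by
    rw [hp, le_div_iff₀ hd]; unfold c2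
    nlinarith [mul_nonneg hs.le (mul_nonneg hs.le (sq_nonneg (s - 1)))]
  have hTp : tent s p = q := by rw [tent_le_half h1 hp1, hp, hq]; field_simp
  have hTq : tent s q = p := by rw [tent_ge_half h1 hq1, hp, hq]; field_simp; ring
  have hpq : p ≠ q := by
    intro h
    rw [hp, hq, div_left_inj' hd.ne'] at h
    nlinarith
  let x : invLim s := ⟨fun n => if Even n then p else q, by
    intro n; dsimp only; split_ifs
    · exact ⟨hp0.le, by linarith⟩
    · exact ⟨hq0.le, hq2⟩, by
    intro n; dsimp only
    by_cases hn : Even n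
    · have : ¬ Even (n + 1) := by rw [Nat.even_add_one]; simpa using hn
      rw [if_pos hn, if_neg this, hTq]
    · have : Even (n + 1) := by rw [Nat.even_add_one]; exact hn
      rw [if_neg hn, if_pos this, hTp]⟩
  have hx : ¬ Low x := by
    rintro ⟨n, hn⟩
    simp only [x] at hn
    split_ifs at hn <;> linarith
  refine ⟨x, shiftInvFun s x, ?_, hx, ?_⟩
  · intro h
    have := congrArg (fun z : invLim s => z.1 0) h
    simp only [x, shiftInvFun] at this
    simp at this
    exact hpq this
  · rintro ⟨n, hn⟩
    exact hx ⟨n + 1, hn⟩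

lemma not_irr_of_low (h1 : 1 < s) (h2 : s < 2) {y : invLim s} (hy : Low y) :
    ¬ Irr (phi h1 h2 0) y := by
  obtain ⟨t, ht, rfl⟩ := low_exists h1 h2 hy
  intro h
  have hu := h (phi h1 h2 '' Icc 0 t) (isCompact_Icc.image (phi_continuous h1 h2))
    (IsConnected.image (isConnected_Icc ht) _ (phi_continuous h1 h2).continuousOn)
    (mem_image_of_mem _ (left_mem_Icc.2 ht)) (mem_image_of_mem _ (right_mem_Icc.2 ht))
  obtain ⟨x, _, _, hx, _⟩ := two_core h1 h2
  have hx' : x ∈ phi h1 h2 '' Icc 0 t := by rw [hu]; trivial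
  obtain ⟨u, hu, rfl⟩ := hx'
  exact hx (low_phi h1 h2 hu.1)

lemma irr_map (h : invLim s ≃ₜ invLim s) {x y : invLim s} (hi : Irr x y) : Irr (h x) (h y) := by
  intro A hA hAc hx hy
  have := hi (h.symm '' A) (hA.image h.symm.continuous)
    (hAc.image _ h.symm.continuous.continuousOn) ⟨h x, hx, by simp⟩ ⟨h y, hy, by simp⟩
  rw [eq_univ_iff_forall] at this ⊢
  intro z
  obtain ⟨a, ha, hae⟩ := this (h.symm z)
  rwa [← h.symm.injective hae]

lemma h_zero (h1 : 1 < s) (h2 : s < 2) (h : invLim s ≃ₜ invLim s) :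
    h (phi h1 h2 0) = phi h1 h2 0 := by
  by_contra hne
  obtain ⟨x, y, hxy, hx, hy⟩ := two_core h1 h2
  have a : h x = phi h1 h2 0 := by
    by_contra hc
    exact not_irr h1 h2 hne hc (irr_map h (irr_of_not_low h1 h2 hx))
  have b : h y = phi h1 h2 0 := by
    by_contra hc
    exact not_irr h1 h2 hne hc (irr_map h (irr_of_not_low h1 h2 hy))
  exact hxy (h.injective (a.trans b.symm))

lemma h_low (h1 : 1 < s) (h2 : s < 2) (h : invLim s ≃ₜ invLim s) {x : invLim s} (hx : Low x) :
    Low (h x) := by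
  by_contra hc
  have := irr_map h.symm (irr_of_not_low h1 h2 hc)
  rw [h_zero, h.symm_apply_apply] at this
  exact not_irr_of_low h1 h2 hx this

lemma uc_homeo (h1 : 1 < s) (h : invLim s ≃ₜ invLim s) (M : ℕ) {δ : ℝ} (hδ : 0 < δ) :
    ∃ (N : ℕ) (κ : ℝ), 0 < κ ∧ ∀ x y : invLim s, |x.1 N - y.1 N| ≤ κ →
      |(h x).1 M - (h y).1 M| ≤ δ := by
  have hs : 0 < s := by linarith
  by_contra hcon
  push Not at hcon
  have hc := fun N : ℕ => hcon N (1 / (((N : ℝ) + 1) * s ^ N)) (by positivity)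
  choose x y hxy hd using hc
  obtain ⟨x0, _, φ, hφ, hx0⟩ := isCompact_univ.tendsto_subseq (fun n => mem_univ (x n))
  have hd0 : ∀ n, Tendsto (fun N => (x N).1 n - (y N).1 n) atTop (𝓝 0) := by
    intro n
    refine squeeze_zero_norm' ?_ (tendsto_one_div_add_atTop_nhds_zero_nat (𝕜 := ℝ))
    filter_upwards [eventually_ge_atTop n] with N hN
    rw [Real.norm_eq_abs]
    refine (coord_lip h1 (x N) (y N) hN).trans ?_
    have a : s ^ (N - n) ≤ s ^ N := pow_le_pow_right₀ h1.le (Nat.sub_le _ _)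
    have hpN : 0 < s ^ N := by positivity
    calc s ^ (N - n) * |(x N).1 N - (y N).1 N| ≤ s ^ N * (1 / (((N : ℝ) + 1) * s ^ N)) :=
          mul_le_mul a (hxy N) (abs_nonneg _) hpN.le
      _ = 1 / ((N : ℝ) + 1) := by field_simp
  have hy0 : Tendsto (y ∘ φ) atTop (𝓝 x0) := by
    rw [tendsto_iff_coord] at hx0 ⊢
    intro n
    have := (hx0 n).sub ((hd0 n).comp hφ.tendsto_atTop)
    simpa using this
  have hM : Tendsto (fun k => |(h (x (φ k))).1 M - (h (y (φ k))).1 M|) atTop (𝓝 0) := by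
    have a := ((coord_continuous M).comp h.continuous).continuousAt.tendsto.comp hx0
    have b := ((coord_continuous M).comp h.continuous).continuousAt.tendsto.comp hy0
    have := (a.sub b).abs
    simpa using this
  have := ge_of_tendsto hM (Eventually.of_forall fun k => (hd (φ k)).le)
  linarith

lemma exists_eta (h1 : 1 < s) (h2 : s < 2) (h : invLim s ≃ₜ invLim s) (t : ℝ) :
    ∃ u, 0 ≤ u ∧ h (phi h1 h2 t) = phi h1 h2 u := by
  refine low_exists h1 h2 (h_low h1 h2 h ?_)
  have : phi h1 h2 t = phi h1 h2 (max t 0) := by simp [phi]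
  rw [this]
  exact low_phi h1 h2 (le_max_right _ _)

/-- induced map of the ray -/
def eta (h1 : 1 < s) (h2 : s < 2) (h : invLim s ≃ₜ invLim s) (t : ℝ) : ℝ :=
  (exists_eta h1 h2 h t).choose

lemma eta_spec (h1 : 1 < s) (h2 : s < 2) (h : invLim s ≃ₜ invLim s) (t : ℝ) :
    0 ≤ eta h1 h2 h t ∧ h (phi h1 h2 t) = phi h1 h2 (eta h1 h2 h t) :=
  (exists_eta h1 h2 h t).choose_spec

lemma eta_inv (h1 : 1 < s) (h2 : s < 2) (h : invLim s ≃ₜ invLim s) {t : ℝ} (ht : 0 ≤ t) :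
    eta h1 h2 h.symm (eta h1 h2 h t) = t := by
  refine phi_inj h1 h2 (eta_spec h1 h2 h.symm _).1 ht ?_
  rw [← (eta_spec h1 h2 h.symm _).2, ← (eta_spec h1 h2 h t).2, h.symm_apply_apply]

lemma eta_cont (h1 : 1 < s) (h2 : s < 2) (h : invLim s ≃ₜ invLim s) :
    Continuous (eta h1 h2 h) := by
  rw [continuous_iff_continuousAt]
  intro t0
  obtain ⟨N, hN⟩ : Low (h (phi h1 h2 t0)) := by
    rw [(eta_spec h1 h2 h t0).2]; exact low_phi h1 h2 (eta_spec h1 h2 h t0).1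
  have hc : Continuous (fun t => (h (phi h1 h2 t)).1 N) :=
    (coord_continuous N).comp (h.continuous.comp (phi_continuous h1 h2))
  have hev : ∀ᶠ t in 𝓝 t0, (h (phi h1 h2 t)).1 N < c2 s :=
    hc.continuousAt.eventually_lt continuousAt_const hN
  have : ContinuousAt (fun t => s ^ N * (h (phi h1 h2 t)).1 N) t0 :=
    (continuous_const.mul hc).continuousAt
  refine this.congr ?_
  filter_upwards [hev] with t ht
  have e := low_eq h1 h2 ht
  nth_rewrite 1 [(eta_spec h1 h2 h t).2] at e
  exact (phi_inj h1 h2 (eta_spec h1 h2 h t).1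
    (mul_nonneg (by positivity) ((h (phi h1 h2 t)).2.1 N).1) e).symm

lemma eta_ray (h1 : 1 < s) (h2 : s < 2) (h : invLim s ≃ₜ invLim s) :
    RayH s (eta h1 h2 h) (eta h1 h2 h.symm) where
  nonneg t _ := (eta_spec h1 h2 h t).1
  inv t ht := eta_inv h1 h2 h ht
  cont := (eta_cont h1 h2 h).continuousOn
  mono := by
    have e0 : eta h1 h2 h 0 = 0 := by
      refine phi_inj h1 h2 (eta_spec h1 h2 h 0).1 le_rfl ?_
      rw [← (eta_spec h1 h2 h 0).2, h_zero]
    intro x hx y hy hxy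
    have hy' : (0 : ℝ) ≤ y := hy
    have := ContinuousOn.strictMonoOn_of_injOn_Icc (f := eta h1 h2 h) hy'
      (by rw [e0]; exact (eta_spec h1 h2 h y).1) (eta_cont h1 h2 h).continuousOn
      (by
        intro a ha b hb hab
        rw [← eta_inv h1 h2 h ha.1, ← eta_inv h1 h2 h hb.1, hab])
    exact this ⟨hx, hxy.le⟩ (right_mem_Icc.2 hy') hxy
  uc := by
    intro M δ hδ
    obtain ⟨N, κ, hκ, hu⟩ := uc_homeo h1 h M hδ
    refine ⟨N, κ, hκ, fun t t' ht ht' hk => ?_⟩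
    have := hu (phi h1 h2 t) (phi h1 h2 t') (by
      rw [phi_coord h1 h2 ht, phi_coord h1 h2 ht']; exact hk)
    rwa [(eta_spec h1 h2 h t).2, (eta_spec h1 h2 h t').2, phi_coord h1 h2 (eta_spec h1 h2 h t).1,
      phi_coord h1 h2 (eta_spec h1 h2 h t').1] at this

lemma exists_NR (h1 : 1 < s) (hnr : (1 : ℝ) / 2 ∉ omegaSet (tent s) (1 / 2)) : ∃ ε, NR s ε := by
  have hne : ∀ p, 1 ≤ p → (tent s)^[p] (1 / 2) ≠ 1 / 2 := by
    intro p hp he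
    apply hnr
    refine ⟨fun k => p * k, fun a b hab => Nat.mul_lt_mul_of_pos_left hab (by omega), ?_⟩
    refine tendsto_const_nhds.congr fun k => ?_
    rw [iterate_mul]
    exact (iterate_fixed he k).symm
  by_contra hcon
  push Not at hcon
  have hfin : ∀ N : ℕ, ∃ ε > 0, ∀ n, 1 ≤ n → n < N → ε ≤ |(tent s)^[n] (1 / 2) - 1 / 2| := by
    intro N
    induction N with
    | zero => exact ⟨1, one_pos, fun n _ h => absurd h (by omega)⟩
    | succ N ih =>
      obtain ⟨ε, hε, h⟩ := ih
      by_cases hN : 1 ≤ N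
      · refine ⟨min ε |(tent s)^[N] (1 / 2) - 1 / 2|, lt_min hε (abs_pos.2 (sub_ne_zero.2 (hne N hN))), ?_⟩
        intro n hn hnN
        rcases Nat.lt_succ_iff_lt_or_eq.1 hnN with hl | rfl
        · exact (min_le_left _ _).trans (h n hn hl)
        · exact min_le_right _ _
      · exact ⟨ε, hε, fun n hn hnN => h n hn (by omega)⟩
  have hfr : ∀ k : ℕ, ∃ᶠ n in atTop, |(tent s)^[n] (1 / 2) - 1 / 2| < 1 / ((k : ℝ) + 1) := by
    intro k
    rw [frequently_atTop]
    intro N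
    by_contra hc
    push Not at hc
    obtain ⟨ε, hε, h⟩ := hfin N
    refine hcon (min ε (1 / ((k : ℝ) + 1))) ⟨lt_min hε (by positivity), fun n hn => ?_⟩
    rcases lt_or_ge n N with hl | hl
    · exact (min_le_left _ _).trans (h n hn hl)
    · exact (min_le_right _ _).trans (hc n hl)
  obtain ⟨φ, hφ, hp⟩ := extraction_forall_of_frequently hfr
  apply hnr
  refine ⟨φ, hφ, ?_⟩
  rw [tendsto_iff_norm_sub_tendsto_zero]
  refine squeeze_zero (fun _ => norm_nonneg _) (fun k => ?_)
    (tendsto_one_div_add_atTop_nhds_zero_nat (𝕜 := ℝ))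
  rw [Real.norm_eq_abs]
  exact (hp k).le

lemma shiftInv_iter_coord (x : invLim s) (k n : ℕ) :
    ((shiftInvFun s)^[k] x).1 n = x.1 (n + k) := by
  induction k generalizing x with
  | zero => rfl
  | succ k ih => rw [iterate_succ_apply, ih]; rfl

lemma shiftFwd_iter_coord (hs1 : Real.sqrt 2 < s) (hs2 : s < 2) (x : invLim s) (k n : ℕ) :
    ((shiftFwdFun s hs1 hs2)^[k] x).1 (n + k) = x.1 n := by
  induction k generalizing x with
  | zero => rfl
  | succ k ih =>
    have := ih (shiftFwdFun s hs1 hs2 x)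
    rw [iterate_succ_apply', ← add_assoc]
    exact ih x

lemma shiftZ_coord (hs1 : Real.sqrt 2 < s) (hs2 : s < 2) (b : ℤ) (x : invLim s) {n m : ℕ}
    (hnm : (n : ℤ) = m + b) : (shiftZ s hs1 hs2 b x).1 n = x.1 m := by
  unfold shiftZ
  split_ifs with hb
  · have : n = m + b.toNat := by omega
    rw [this]; exact shiftFwd_iter_coord hs1 hs2 x _ _
  · have e : n + (-b).toNat = m := by omega
    rw [shiftInv_iter_coord, e]

lemma salient_coord (h1 : 1 < s) (h2 : s < 2) {i m : ℕ} (him : i ≤ m) :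
    (phi h1 h2 (s ^ m * (1 / 2))).1 i = (tent s)^[m - i] (1 / 2) := by
  have hp : 0 < s ^ m := by positivity
  rw [phi_coord h1 h2 (by positivity)]
  have e := rayF_iter h1 (s ^ m * (1 / 2)) i (m - i)
  rw [show i + (m - i) = m by omega, mul_div_cancel_left₀ _ hp.ne', rayF_id h1 (by linarith)] at e
  exact e.symm

lemma fold_approx (h1 : 1 < s) (h2 : s < 2) {x : invLim s} (hx : x ∈ foldingPts s) :
    ∃ m : ℕ → ℕ, (∀ N, N ≤ m N) ∧
      Tendsto (fun N => phi h1 h2 (s ^ (m N) * (1 / 2))) atTop (𝓝 x) := by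
  have hs : 0 < s := by linarith
  have key : ∀ N : ℕ, ∃ m, N ≤ m ∧
      |(phi h1 h2 (s ^ m * (1 / 2))).1 N - x.1 N| ≤ 1 / (((N : ℝ) + 1) * s ^ N) := by
    intro N
    obtain ⟨φ, hφ, ht⟩ := hx N
    have hpos : 0 < 1 / (((N : ℝ) + 1) * s ^ N) := by positivity
    obtain ⟨k, hk⟩ := ((Metric.tendsto_nhds.1 ht) _ hpos).exists
    refine ⟨φ k + N, by omega, ?_⟩
    rw [salient_coord h1 h2 (by omega), Nat.add_sub_cancel]
    rw [Real.dist_eq] at hk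
    exact hk.le
  choose m hm hk using key
  refine ⟨m, hm, ?_⟩
  rw [tendsto_iff_coord]
  intro n
  rw [tendsto_iff_norm_sub_tendsto_zero]
  refine squeeze_zero' (Eventually.of_forall fun _ => norm_nonneg _) ?_
    (tendsto_one_div_add_atTop_nhds_zero_nat (𝕜 := ℝ))
  filter_upwards [eventually_ge_atTop n] with N hN
  rw [Real.norm_eq_abs]
  refine (coord_lip h1 _ x hN).trans ?_
  have a : s ^ (N - n) ≤ s ^ N := pow_le_pow_right₀ h1.le (Nat.sub_le _ _)
  have hpN : 0 < s ^ N := by positivity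
  calc _ ≤ s ^ N * (1 / (((N : ℝ) + 1) * s ^ N)) :=
        mul_le_mul a (hk N) (abs_nonneg _) hpN.le
    _ = 1 / ((N : ℝ) + 1) := by field_simp

lemma final (hs1 : Real.sqrt 2 < s) (hs2 : s < 2)
    (hnr : (1 : ℝ) / 2 ∉ omegaSet (tent s) (1 / 2)) (h : invLim s ≃ₜ invLim s) :
    ∃ b : ℤ, (∀ x ∈ foldingPts s, h x = shiftZ s hs1 hs2 (-b) x) ∧
      ∀ x : invLim s, ∃ A : Set (invLim s), IsCompact A ∧ IsConnected A ∧ A ≠ univ ∧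
        h x ∈ A ∧ shiftZ s hs1 hs2 (-b) x ∈ A := by
  have h1 : 1 < s := by
    refine lt_trans ?_ hs1
    rw [Real.lt_sqrt (by norm_num)]; norm_num
  obtain ⟨ε, hε⟩ := exists_NR h1 hnr
  obtain ⟨b, hb⟩ := main_asymp h1 hs2 hε (eta_ray h1 hs2 h) (eta_ray h1 hs2 h.symm)
  refine ⟨-b, fun x hx => ?_, fun x => ?_⟩
  · rw [neg_neg]
    obtain ⟨m, hm, ht⟩ := fold_approx h1 hs2 hx
    refine ext_tail b.natAbs fun i hi => ?_
    obtain ⟨j, hj⟩ : ∃ j : ℕ, (i : ℤ) = j + b := ⟨(i - b).toNat, by omega⟩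
    rw [shiftZ_coord hs1 hs2 b x hj]
    have t1 : Tendsto (fun N => (h (phi h1 hs2 (s ^ (m N) * (1 / 2)))).1 i) atTop
        (𝓝 ((h x).1 i)) :=
      (((coord_continuous i).comp h.continuous).tendsto x).comp ht
    have t2 : Tendsto (fun N => (phi h1 hs2 (s ^ (m N) * (1 / 2))).1 j) atTop (𝓝 (x.1 j)) :=
      ((coord_continuous j).tendsto x).comp ht
    have t3 : Tendsto (fun N => (h (phi h1 hs2 (s ^ (m N) * (1 / 2)))).1 i
        - (phi h1 hs2 (s ^ (m N) * (1 / 2))).1 j) atTop (𝓝 0) := by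
      rw [Metric.tendsto_atTop]
      intro e he
      obtain ⟨N, hN⟩ := hb (e / 2) (by positivity)
      refine ⟨max N (max i j), fun n hn => ?_⟩
      have hmn := hm n
      obtain ⟨l, hl, hle⟩ := hN (m n) (by omega)
      have hil : i ≤ l := by omega
      rw [Real.dist_eq, sub_zero, (eta_spec h1 hs2 h _).2,
        phi_coord h1 hs2 (eta_spec h1 hs2 h _).1, salient_coord h1 hs2 (by omega),
        show m n - j = l - i by omega]
      have nc := (near_crit h1 (eta h1 hs2 h (s ^ m n * (1 / 2))) hil).trans hle
      have hpi : 1 ≤ s ^ i := one_le_pow₀ h1.le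
      have := le_mul_of_one_le_right (abs_nonneg
        (rayF s (eta h1 hs2 h (s ^ m n * (1 / 2)) / s ^ i) - (tent s)^[l - i] (1 / 2))) hpi
      linarith
    have t4 := t1.sub t2
    have := tendsto_nhds_unique t3 t4
    linarith
  · rw [neg_neg]
    have hz : ∀ n, (phi h1 hs2 0).1 n = 0 := by
      intro n
      rw [phi_coord h1 hs2 le_rfl, zero_div, rayF_id h1 (by linarith)]
    have hiff : shiftZ s hs1 hs2 b x = phi h1 hs2 0 ↔ x = phi h1 hs2 0 := by
      constructor
      · intro he
        refine ext_tail b.natAbs fun j hj => ?_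
        obtain ⟨i, hi⟩ : ∃ i : ℕ, (i : ℤ) = j + b := ⟨(j + b).toNat, by omega⟩
        rw [← shiftZ_coord hs1 hs2 b x hi, he, hz, hz]
      · rintro rfl
        refine ext_tail b.natAbs fun i hi => ?_
        obtain ⟨j, hj⟩ : ∃ j : ℕ, (i : ℤ) = j + b := ⟨(i - b).toNat, by omega⟩
        rw [shiftZ_coord hs1 hs2 b _ hj, hz, hz]
    by_cases hx : x = phi h1 hs2 0
    · refine ⟨{phi h1 hs2 0}, isCompact_singleton, isConnected_singleton, ?_, ?_, hiff.2 hx⟩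
      · intro hu
        obtain ⟨p, q, hpq, _, _⟩ := two_core h1 hs2
        have a : p ∈ ({phi h1 hs2 0} : Set (invLim s)) := by rw [hu]; trivial
        have c : q ∈ ({phi h1 hs2 0} : Set (invLim s)) := by rw [hu]; trivial
        exact hpq (a.trans c.symm)
      · rw [hx]; exact h_zero h1 hs2 h
    · refine prop_cont h1 hs2 ?_ (fun he => hx (hiff.1 he))
      intro he
      apply hx
      exact h.injective (he.trans (h_zero h1 hs2 h).symm)

end TentProof


/-- there is `b : ℤ` with `h = σ̂^{-b}` on folding points, and for every `x̄ ∈ K`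
the points `h(x̄)` and `σ̂^{-b}(x̄)` lie in the same composant of `K`. -/
theorem statement2 (s : ℝ) (hs1 : Real.sqrt 2 < s) (hs2 : s < 2)
    (hnr : (1 : ℝ) / 2 ∉ omegaSet (tent s) (1 / 2))
    (h : invLim s ≃ₜ invLim s) :
    ∃ b : ℤ, (∀ x ∈ foldingPts s, h x = shiftZ s hs1 hs2 (-b) x) ∧
      ∀ x : invLim s, ∃ A : Set (invLim s), IsCompact A ∧ IsConnected A ∧ A ≠ univ ∧
        h x ∈ A ∧ shiftZ s hs1 hs2 (-b) x ∈ A := by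
  exact TentProof.final hs1 hs2 hnr h
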